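/- Let α ∈ (0,1), let μ be an α-irrigable positive bounded Radon measure on ℝ^d, let χ be an optimal irrigation plan for μ, and let Z be the landscape function of χ. Then I^α(μ) = ∫_{ℝ^d} Z(x) dμ(x). -/

import Mathlib

open MeasureTheory Filter Metric Set
open scoped ENNReal Topology RealInnerProductSpace

noncomputable section

/-- Points of `ℝ^d`, with the Euclidean norm. -/
abbrev Euc (d : ℕ) : Type := EuclideanSpace ℝ (Fin d)

/-- An admissible irrigation plan for the (positive, bounded, Radon) measure `μ` on `ℝ^d`:
particles are parametrized by `θ ∈ [0, M]` where `M = μ(ℝ^d)`; each particle path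
`t ↦ χ(θ,t)` is 1-Lipschitz, starts at the origin, has unit speed up to its stopping time
`T θ` and is constant afterwards; the push-forward of Lebesgue measure on `[0,M]` under
`θ ↦ χ(θ, T θ)` is `μ`. -/
structure IrrigationPlan {d : ℕ} (μ : Measure (Euc d)) where
  toFun : ℝ → ℝ → Euc d
  T : ℝ → ℝ
  measurable : Measurable (Function.uncurry toFun)
  T_nonneg : ∀ θ, 0 ≤ T θ
  lipschitz : ∀ θ ∈ Icc (0 : ℝ) (μ univ).toReal, LipschitzWith 1 (toFun θ)
  unit_speed : ∀ θ ∈ Icc (0 : ℝ) (μ univ).toReal,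
      ∀ᵐ t ∂(volume.restrict (Icc (0 : ℝ) (T θ))), ‖deriv (toFun θ) t‖ = 1
  stopped : ∀ θ ∈ Icc (0 : ℝ) (μ univ).toReal, ∀ t, T θ ≤ t → toFun θ t = toFun θ (T θ)
  start : ∀ θ ∈ Icc (0 : ℝ) (μ univ).toReal, toFun θ 0 = 0
  irrigates : Measure.map (fun θ => toFun θ (T θ))
      (volume.restrict (Icc (0 : ℝ) (μ univ).toReal)) = μ

/-- The multiplicity (total flux) `|x|_χ` of the plan `χ` at a point `x`. -/
def IrrigationPlan.mult {d : ℕ} {μ : Measure (Euc d)} (χ : IrrigationPlan μ) (x : Euc d) : ℝ≥0∞ :=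
  volume {θ : ℝ | θ ∈ Icc (0 : ℝ) (μ univ).toReal ∧ ∃ t, 0 ≤ t ∧ χ.toFun θ t = x}

/-- The total cost `E^α(χ)` of an irrigation plan `χ`. -/
def IrrigationPlan.cost {d : ℕ} {μ : Measure (Euc d)} (α : ℝ) (χ : IrrigationPlan μ) : ℝ≥0∞ :=
  ∫⁻ θ in Icc (0 : ℝ) (μ univ).toReal,
    ∫⁻ t in Ici (0 : ℝ),
      χ.mult (χ.toFun θ t) ^ (α - 1) * ENNReal.ofReal ‖deriv (χ.toFun θ) t‖

/-- The α-irrigation cost `I^α(μ)` of the measure `μ` from the origin: the infimum of the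
costs of all admissible plans (`+∞` if there is none). -/
def irrigationCost {d : ℕ} (α : ℝ) (μ : Measure (Euc d)) : ℝ≥0∞ :=
  ⨅ χ : IrrigationPlan μ, χ.cost α

/-- A plan is optimal if it attains the α-irrigation cost. -/
def IrrigationPlan.IsOptimal {d : ℕ} {μ : Measure (Euc d)} (α : ℝ) (χ : IrrigationPlan μ) : Prop :=
  χ.cost α = irrigationCost α μ

/-- The value `Z_χ(x) = ∫_0^τ |χ(θ,t)|_χ^{α-1} dt`, where `χ(θ,τ) = x`; for plans with the
single path property this quantity is independent of the choice of `(θ,τ)`. -/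
def IrrigationPlan.Zchi {d : ℕ} {μ : Measure (Euc d)} (α : ℝ) (χ : IrrigationPlan μ)
    (x : Euc d) : ℝ≥0∞ :=
  ⨅ (θ : ℝ) (_ : θ ∈ Icc (0 : ℝ) (μ univ).toReal) (τ : ℝ) (_ : 0 ≤ τ) (_ : χ.toFun θ τ = x),
    ∫⁻ t in Icc (0 : ℝ) τ, χ.mult (χ.toFun θ t) ^ (α - 1)

/-- The landscape function: the lower semicontinuous envelope of `Z_χ` along
`Γ = {y : |y|_χ > 0}`, with value `+∞` outside the closure of `Γ`. -/
def IrrigationPlan.landscape {d : ℕ} {μ : Measure (Euc d)} (α : ℝ) (χ : IrrigationPlan μ)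
    (x : Euc d) : ℝ≥0∞ :=
  Filter.liminf (χ.Zchi α) (𝓝[{y | 0 < χ.mult y}] x)

open scoped NNReal in
theorem exists_min_path {d : ℕ} {R : Set (Euc d)} (hR : IsCompact R) {f : ℝ → Euc d}
    (hf : LipschitzWith 1 f) {L : ℝ} (hL : 0 ≤ L) (hfR : ∀ t ∈ Icc 0 L, f t ∈ R) :
    ∃ ℓ : ℝ, 0 ≤ ℓ ∧ (∃ g : ℝ → Euc d, LipschitzWith 1 g ∧ (∀ t, g t ∈ R) ∧ g 0 = f 0 ∧ g ℓ = f L) ∧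
      ∀ ℓ' : ℝ, 0 ≤ ℓ' → ∀ g : ℝ → Euc d, LipschitzWith 1 g → (∀ t, g t ∈ R) → g 0 = f 0 →
        g ℓ' = f L → ℓ ≤ ℓ' := by
  classical
  set Λ : Set ℝ := {ℓ | 0 ≤ ℓ ∧ ∃ g : ℝ → Euc d, LipschitzWith 1 g ∧ (∀ t, g t ∈ R) ∧
    g 0 = f 0 ∧ g ℓ = f L} with hΛ
  have hne : Λ.Nonempty := by
    refine ⟨L, hL, fun t => f (projIcc 0 L hL t), ?_, ?_, ?_, ?_⟩
    · have h1 : LipschitzWith 1 (fun t => ((projIcc 0 L hL t : Icc (0:ℝ) L) : ℝ)) := by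
        have := (LipschitzWith.projIcc hL)
        exact this
      have h2 := hf.comp h1
      rw [mul_one] at h2
      exact h2
    · intro t; exact hfR _ (projIcc 0 L hL t).2
    · simp
    · simp
  have hbdd : BddBelow Λ := ⟨0, fun x hx => hx.1⟩
  set ℓ := sInf Λ with hℓ
  have hℓ0 : 0 ≤ ℓ := le_csInf hne (fun x hx => hx.1)
  refine ⟨ℓ, hℓ0, ?_, ?_⟩
  · obtain ⟨u, hua, hut, huΛ⟩ := exists_seq_tendsto_sInf hne hbdd
    choose hu0 g hg hgR hg0 hgu using huΛ
    let U : Ultrafilter ℕ := Filter.hyperfilter ℕ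
    have hU : (U : Filter ℕ) ≤ atTop := Nat.hyperfilter_le_atTop
    have hlim : ∀ t, ∃ y ∈ R, Tendsto (fun n => g n t) U (𝓝 y) := by
      intro t
      have := hR.ultrafilter_le_nhds (U.map (fun n => g n t))
        (by
          rw [Ultrafilter.coe_map, le_principal_iff]
          exact Filter.mem_map.2 (Filter.univ_mem' (fun n => hgR n t)))
      exact this
    choose G hGR hG using hlim
    refine ⟨G, ?_, hGR, ?_, ?_⟩
    · refine LipschitzWith.of_dist_le_mul ?_
      intro s t
      refine le_of_tendsto ((hG s).dist (hG t)) (Eventually.of_forall fun n => (hg n).dist_le_mul s t)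
    · exact tendsto_nhds_unique (hG 0) (by simp [hg0])
    · have h1 : Tendsto (fun n => g n ℓ) U (𝓝 (f L)) := by
        rw [tendsto_iff_dist_tendsto_zero]
        have h2 : Tendsto (fun n => dist ℓ (u n)) U (𝓝 0) := by
          have : Tendsto (fun n => dist ℓ (u n)) atTop (𝓝 (dist ℓ ℓ)) := tendsto_const_nhds.dist hut
          rw [dist_self] at this
          exact this.mono_left hU
        refine squeeze_zero (fun _ => dist_nonneg) (fun n => ?_) h2
        have := (hg n).dist_le_mul ℓ (u n)
        rw [hgu n] at this
        simpa using this
      exact tendsto_nhds_unique (hG ℓ) h1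
  · intro ℓ' h0 g hg hgR hg0 hgL
    exact csInf_le hbdd ⟨h0, g, hg, hgR, hg0, hgL⟩

theorem lip_eVariation_le {d : ℕ} {g : ℝ → Euc d} (hg : LipschitzWith 1 g) (a b : ℝ) :
    eVariationOn g (Icc a b) ≤ ENNReal.ofReal (b - a) := by
  have h := (hg.lipschitzOnWith (s := (univ : Set ℝ))).comp_eVariationOn_le
    (f := g) (g := id) (s := Icc a b) (fun _ _ => mem_univ _)
  rw [Function.comp_id, eVariationOn_id_Icc] at h
  simpa using h

/-- minimal paths have full variation -/
theorem min_path_variation {d : ℕ} {R : Set (Euc d)} {g : ℝ → Euc d} {x y : Euc d}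
    (hg : LipschitzWith 1 g) {ℓ : ℝ} (hℓ : 0 ≤ ℓ) (hgR : ∀ t, g t ∈ R) (hg0 : g 0 = x) (hgl : g ℓ = y)
    (hmin : ∀ ℓ' : ℝ, 0 ≤ ℓ' → ∀ g : ℝ → Euc d, LipschitzWith 1 g → (∀ t, g t ∈ R) → g 0 = x →
        g ℓ' = y → ℓ ≤ ℓ') :
    ENNReal.ofReal ℓ ≤ eVariationOn g (Icc 0 ℓ) := by
  classical
  have hfin : ∀ a b, eVariationOn g (Icc a b) ≠ ⊤ := fun a b =>
    ne_top_of_le_ne_top ENNReal.ofReal_ne_top (lip_eVariation_le hg a b)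
  set σ : ℝ → ℝ := fun t => (eVariationOn g (Icc 0 t)).toReal with hσ
  have hadd : ∀ s t, 0 ≤ s → s ≤ t → σ t = σ s + (eVariationOn g (Icc s t)).toReal := by
    intro s t h0 hst
    have := eVariationOn.Icc_add_Icc g (s := univ) h0 hst (mem_univ s)
    simp only [univ_inter] at this
    rw [hσ]
    simp only
    rw [← this, ENNReal.toReal_add (hfin _ _) (hfin _ _)]
  have hd1 : ∀ s t, 0 ≤ s → s ≤ t → dist (g s) (g t) ≤ σ t - σ s := by
    intro s t h0 hst
    rw [hadd s t h0 hst, add_sub_cancel_left, dist_edist]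
    exact ENNReal.toReal_mono (hfin _ _)
      (eVariationOn.edist_le g (left_mem_Icc.2 hst) (right_mem_Icc.2 hst))
  have hd2 : ∀ s t, 0 ≤ s → s ≤ t → σ t - σ s ≤ t - s := by
    intro s t h0 hst
    rw [hadd s t h0 hst, add_sub_cancel_left]
    refine ENNReal.toReal_le_of_le_ofReal (by linarith) (lip_eVariation_le hg s t)
  have hmono : ∀ s t, 0 ≤ s → s ≤ t → σ s ≤ σ t := fun s t h0 hst => by
    have := hd1 s t h0 hst
    have h3 : 0 ≤ dist (g s) (g t) := dist_nonneg
    linarith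
  have hσ0 : σ 0 = 0 := by simp [hσ, eVariationOn.subsingleton]
  set V := σ ℓ with hV
  have hV0 : 0 ≤ V := ENNReal.toReal_nonneg
  have hcont : ContinuousOn σ (Icc 0 ℓ) := by
    have : LipschitzOnWith 1 σ (Icc 0 ℓ) := by
      refine LipschitzOnWith.of_dist_le_mul ?_
      intro s hs t ht
      rcases le_total s t with h | h
      · rw [dist_comm, dist_comm s t, Real.dist_eq, Real.dist_eq, abs_of_nonneg (by linarith [hmono s t hs.1 h]), abs_of_nonneg (by linarith)]
        simpa using hd2 s t hs.1 h
      · rw [Real.dist_eq, Real.dist_eq, abs_of_nonneg (by linarith [hmono t s ht.1 h]), abs_of_nonneg (by linarith)]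
        simpa using hd2 t s ht.1 h
    exact this.continuousOn
  have hsurj : ∀ v ∈ Icc 0 V, ∃ t ∈ Icc 0 ℓ, σ t = v := by
    intro v hv
    have := intermediate_value_Icc hℓ hcont
    rw [hσ0] at this
    exact this hv
  have hdist : ∀ s ∈ Icc 0 ℓ, ∀ t ∈ Icc 0 ℓ, dist (g s) (g t) ≤ |σ s - σ t| := by
    intro s hs t ht
    rcases le_total s t with h | h
    · have := hd1 s t hs.1 h
      rw [abs_sub_comm]
      exact this.trans (le_abs_self _)
    · have := hd1 t s ht.1 h
      rw [dist_comm]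
      exact this.trans (le_abs_self _)
  choose! r hr hrσ using hsurj
  have hkey : ℓ ≤ V := by
    refine hmin V hV0 (fun v => g (r (projIcc 0 V hV0 v))) ?_ (fun _ => hgR _) ?_ ?_
    · refine LipschitzWith.of_dist_le_mul ?_
      intro a b
      have h1 := hdist _ (hr _ (projIcc 0 V hV0 a).2) _ (hr _ (projIcc 0 V hV0 b).2)
      rw [hrσ _ (projIcc 0 V hV0 a).2, hrσ _ (projIcc 0 V hV0 b).2] at h1
      refine h1.trans ?_
      have := (LipschitzWith.projIcc hV0).dist_le_mul a b
      exact this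
    · have h1 := hdist _ (hr 0 (left_mem_Icc.2 hV0)) 0 (left_mem_Icc.2 hℓ)
      rw [hrσ 0 (left_mem_Icc.2 hV0), hσ0] at h1
      simp only [projIcc_left]
      rw [← hg0]
      simpa using h1
    · have h1 := hdist _ (hr V (right_mem_Icc.2 hV0)) ℓ (right_mem_Icc.2 hℓ)
      rw [hrσ V (right_mem_Icc.2 hV0)] at h1
      simp only [projIcc_right]
      rw [← hgl]
      simpa [hV] using h1
  exact ENNReal.ofReal_le_of_le_toReal hkey

/-- minimal paths are injective -/
theorem min_path_inj {d : ℕ} {R : Set (Euc d)} {g : ℝ → Euc d} {x y : Euc d}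
    (hg : LipschitzWith 1 g) {ℓ : ℝ} (hgR : ∀ t, g t ∈ R) (hg0 : g 0 = x) (hgl : g ℓ = y)
    (hmin : ∀ ℓ' : ℝ, 0 ≤ ℓ' → ∀ g : ℝ → Euc d, LipschitzWith 1 g → (∀ t, g t ∈ R) → g 0 = x →
        g ℓ' = y → ℓ ≤ ℓ') :
    InjOn g (Icc 0 ℓ) := by
  have key : ∀ s t, 0 ≤ s → s < t → t ≤ ℓ → g s ≠ g t := by
    intro s t h0 hst htl heq
    have hkey : ℓ ≤ ℓ - (t - s) := by
      refine hmin _ (by linarith) (fun r => g (min r s) + g (max r s + (t - s)) - g t) ?_ ?_ ?_ ?_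
      · refine LipschitzWith.of_dist_le_mul ?_
        have aux : ∀ a b, a ≤ b → dist (g (min a s) + g (max a s + (t - s)) - g t) (g (min b s) + g (max b s + (t - s)) - g t) ≤ b - a := by
          intro a b hab
          have e1 := hg.dist_le_mul (min a s) (min b s)
          have e2 := hg.dist_le_mul (max a s + (t - s)) (max b s + (t - s))
          have e3 := dist_add_add_le (g (min a s)) (g (max a s + (t - s))) (g (min b s)) (g (max b s + (t - s)))
          rw [dist_sub_right]
          simp only [NNReal.coe_one, one_mul, Real.dist_eq] at e1 e2
          rw [abs_sub_comm, abs_of_nonneg (by linarith [min_le_min_right s hab])] at e1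
          rw [abs_sub_comm, abs_of_nonneg (by linarith [max_le_max_right s hab])] at e2
          have h4 := min_add_max a s
          have h5 := min_add_max b s
          linarith
        intro a b
        simp only [NNReal.coe_one, one_mul, Real.dist_eq a b]
        rcases le_total a b with h | h
        · rw [abs_sub_comm, abs_of_nonneg (by linarith)]; exact aux a b h
        · rw [abs_of_nonneg (by linarith), dist_comm]; exact aux b a h
      · intro r
        rcases le_total r s with h | h
        · simp only [min_eq_left h, max_eq_right h]
          have : s + (t - s) = t := by ring
          rw [this]; simpa using hgR r
        · simp only [min_eq_right h, max_eq_left h]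
          rw [heq]; simpa using hgR _
      · simp only [min_eq_left h0, max_eq_right h0]
        have : s + (t - s) = t := by ring
        rw [this, hg0]; simp
      · have h : s ≤ ℓ - (t - s) := by linarith
        simp only [min_eq_right h, max_eq_left h]
        rw [heq]
        have : ℓ - (t - s) + (t - s) = ℓ := by ring
        rw [this, hgl]; simp
    linarith
  intro s hs t ht heq
  rcases lt_trichotomy s t with h | h | h
  · exact absurd heq (key s t hs.1 h ht.2)
  · exact h
  · exact absurd heq.symm (key t s ht.1 h hs.2)

open scoped MeasureTheory in
theorem hausd_image_le {d : ℕ} {f : ℝ → Euc d} (hf : LipschitzWith 1 f) (S : Set ℝ) :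
    μH[1] (f '' S) ≤ volume S := by
  have h := hf.hausdorffMeasure_image_le (d := 1) zero_le_one S
  rw [hausdorffMeasure_real] at h
  simpa using h

theorem hausd_restrict_le_map {d : ℕ} {f : ℝ → Euc d} (hf : LipschitzWith 1 f) (a b : ℝ) :
    (μH[1] : Measure (Euc d)).restrict (f '' Icc a b) ≤ (volume.restrict (Icc a b)).map f := by
  refine Measure.le_iff.2 fun B hB => ?_
  rw [Measure.restrict_apply hB, Measure.map_apply hf.continuous.measurable hB,
    Measure.restrict_apply (hf.continuous.measurable hB)]
  refine le_trans (measure_mono ?_) (hausd_image_le hf _)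
  rintro x ⟨hx, t, ht, rfl⟩
  exact ⟨t, ⟨hx, ht⟩, rfl⟩

theorem lintegral_image_le {d : ℕ} {f : ℝ → Euc d} (hf : LipschitzWith 1 f) (a b : ℝ)
    {w : Euc d → ℝ≥0∞} (hw : Measurable w) :
    ∫⁻ x in f '' Icc a b, w x ∂μH[1] ≤ ∫⁻ t in Icc a b, w (f t) := by
  refine (lintegral_mono' (hausd_restrict_le_map hf a b) le_rfl).trans ?_
  rw [lintegral_map hw hf.continuous.measurable]

theorem null_preimage {d : ℕ} {f : ℝ → Euc d} {S : Set ℝ}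
    (hu : ∀ᵐ t ∂(volume.restrict S), ‖deriv f t‖ = 1) (hS : MeasurableSet S)
    {N : Set (Euc d)} (hN : μH[1] N = 0) : volume (S ∩ f ⁻¹' N) = 0 := by
  have hu' : volume {t | ¬ (t ∈ S → ‖deriv f t‖ = 1)} = 0 := by
    rw [ae_restrict_iff' hS] at hu
    exact hu
  let A : ℕ → ℤ → Set ℝ := fun n k => {t | t ∈ Ico ((k:ℝ) / (n+1)) ((k+1) / (n+1)) ∧ f t ∈ N ∧
    ∀ s, |s - t| < 1 / ((n:ℝ)+1) → |s - t| ≤ 2 * ‖f s - f t‖}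
  have hA : ∀ n k, volume (A n k) = 0 := by
    intro n k
    have hanti : AntilipschitzWith 2 (fun t : A n k => f t) := by
      refine AntilipschitzWith.of_le_mul_dist ?_
      rintro ⟨s, hs⟩ ⟨t, ht⟩
      have hn : (0:ℝ) < n + 1 := by positivity
      have e : ((k:ℝ)+1) / (n+1) = k / (n+1) + 1 / (n+1) := by ring
      have := ht.2.2 s (by
        rw [abs_lt]
        have h1 := hs.1; have h2 := ht.1
        rw [e] at h1 h2
        constructor <;> linarith [h1.1, h1.2, h2.1, h2.2])
      rw [Subtype.dist_eq, Real.dist_eq, dist_eq_norm]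
      exact this
    have h1 := hanti.le_hausdorffMeasure_image (d := 1) zero_le_one univ
    have h2 : μH[1] ((fun t : A n k => f t) '' univ) = 0 := by
      refine measure_mono_null ?_ hN
      rintro _ ⟨t, _, rfl⟩
      exact t.2.2.1
    rw [h2, mul_zero] at h1
    have h3 := (isometry_subtype_coe (s := A n k)).hausdorffMeasure_image (d := 1) (Or.inl zero_le_one) univ
    rw [hausdorffMeasure_real] at h3
    rw [image_univ, Subtype.range_coe] at h3
    rw [h3]
    exact le_antisymm h1 (zero_le)
  refine measure_mono_null ?_ (measure_union_null hu' (measure_iUnion_null fun n => measure_iUnion_null (hA n)))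
  rintro t ⟨htS, htN⟩
  by_cases h1 : ‖deriv f t‖ = 1
  · right
    have hd : HasDerivAt f (deriv f t) t := by
      refine DifferentiableAt.hasDerivAt ?_
      by_contra hnd
      rw [deriv_zero_of_not_differentiableAt hnd] at h1
      simp at h1
    have hev : ∀ᶠ s in 𝓝 t, ‖f s - f t - (s - t) • deriv f t‖ ≤ (1/2) * ‖s - t‖ := by
      have := hd.isLittleO.def (show (0:ℝ) < 1/2 by norm_num)
      exact this
    obtain ⟨ε, hε, hball⟩ := Metric.eventually_nhds_iff.1 hev
    obtain ⟨n, hn⟩ := exists_nat_one_div_lt hε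
    have hn0 : (0:ℝ) < n + 1 := by positivity
    refine mem_iUnion.2 ⟨n, mem_iUnion.2 ⟨⌊t * (n+1)⌋, ⟨?_, ?_⟩, htN, ?_⟩⟩
    · rw [div_le_iff₀ hn0]; exact Int.floor_le _
    · rw [lt_div_iff₀ hn0]; exact Int.lt_floor_add_one _
    · intro s hs
      have h2 := hball (show dist s t < ε by rw [Real.dist_eq]; linarith)
      have h3 : ‖(s - t) • deriv f t‖ = |s - t| := by rw [norm_smul, h1, mul_one, Real.norm_eq_abs]
      have h4 := norm_sub_norm_le ((s - t) • deriv f t) (f s - f t)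
      rw [h3, norm_sub_rev ((s - t) • deriv f t)] at h4
      rw [Real.norm_eq_abs] at h2
      linarith
  · left
    change ¬ (t ∈ S → ‖deriv f t‖ = 1)
    rw [Classical.not_imp]
    exact ⟨htS, h1⟩

theorem variation_le_hausd {d : ℕ} {g : ℝ → Euc d} (hg : LipschitzWith 1 g) {ℓ : ℝ}
    (hinj : InjOn g (Icc 0 ℓ)) : eVariationOn g (Icc 0 ℓ) ≤ μH[1] (g '' Icc 0 ℓ) := by
  refine iSup_le ?_
  rintro ⟨n, u, hu, hus⟩
  have h1 : ∀ i, edist (g (u (i+1))) (g (u i)) ≤ μH[1] (g '' Ioc (u i) (u (i+1))) := by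
    intro i
    let φ : Euc d → ℝ := fun x => dist x (g (u i))
    have hφ : LipschitzWith 1 φ := LipschitzWith.dist_left _
    have h2 := hφ.hausdorffMeasure_image_le (d := 1) zero_le_one (g '' Ioc (u i) (u (i+1)))
    rw [hausdorffMeasure_real] at h2
    simp only [ENNReal.coe_one, ENNReal.one_rpow, one_mul] at h2
    refine le_trans ?_ h2
    have h3 : Ioc (φ (g (u i))) (φ (g (u (i+1)))) ⊆ (fun t => φ (g t)) '' Ioc (u i) (u (i+1)) :=
      intermediate_value_Ioc (hu (Nat.le_succ i)) ((hφ.continuous.comp hg.continuous).continuousOn)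
    rw [image_image]
    refine le_trans ?_ (measure_mono h3)
    rw [Real.volume_Ioc]
    simp only [φ, dist_self, sub_zero]
    rw [edist_dist]
  have hsub : ∀ i, Ioc (u i) (u (i+1)) ⊆ Icc 0 ℓ := fun i t ht =>
    ⟨(hus i).1.trans ht.1.le, ht.2.trans (hus (i+1)).2⟩
  calc _ ≤ ∑ i ∈ Finset.range n, μH[1] (g '' Ioc (u i) (u (i+1))) :=
        Finset.sum_le_sum fun i _ => h1 i
    _ = μH[1] (⋃ i ∈ Finset.range n, g '' Ioc (u i) (u (i+1))) := by
        rw [measure_biUnion_finset]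
        · intro i _ j _ hij
          have hd := hu.pairwise_disjoint_on_Ioc_succ hij
          simp only [Function.onFun] at hd ⊢
          rw [Set.disjoint_left]
          rintro x ⟨s, hs, rfl⟩ ⟨t, ht, hts⟩
          have := hinj (hsub j ht) (hsub i hs) hts
          subst this
          exact Set.disjoint_left.1 hd hs ht
        · intro i _
          exact measurableSet_Ioc.image_of_continuousOn_injOn hg.continuous.continuousOn
            (hinj.mono (hsub i))
    _ ≤ _ := by
        refine measure_mono (iUnion₂_subset fun i _ => image_mono (hsub i))

theorem edist_le_lintegral_deriv {d : ℕ} {g : ℝ → Euc d} (hg : LipschitzWith 1 g) {s t : ℝ}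
    (hst : s ≤ t) : edist (g t) (g s) ≤ ∫⁻ r in Ioc s t, ENNReal.ofReal ‖deriv g r‖ := by
  have hdiff : ∀ᵐ r, DifferentiableAt ℝ g r := hg.ae_differentiableAt
  have hb : ∀ r, ‖deriv g r‖ ≤ 1 := fun r => by simpa using norm_deriv_le_of_lipschitz hg (x₀ := r)
  have hint : IntervalIntegrable (fun r => ‖deriv g r‖) volume s t := by
    refine (intervalIntegrable_const (c := (1:ℝ))).mono_fun ?_ ?_
    · exact (measurable_deriv g).norm.aestronglyMeasurable
    · refine Eventually.of_forall fun r => ?_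
      simpa using hb r
  set v := g t - g s with hv
  have h1 : ‖v‖ * ‖v‖ ≤ ‖v‖ * ∫ r in s..t, ‖deriv g r‖ := by
    let φ : ℝ → ℝ := fun r => inner ℝ v (g r)
    have hφ : LipschitzWith ‖v‖₊ φ := by
      have : LipschitzWith ‖v‖₊ (fun y : Euc d => inner ℝ v y) := by
        refine LipschitzWith.of_dist_le_mul fun x y => ?_
        rw [Real.dist_eq, ← inner_sub_right, dist_eq_norm]
        exact abs_real_inner_le_norm _ _
      have h2 := this.comp hg
      rw [mul_one] at h2
      exact h2
    have hac : AbsolutelyContinuousOnInterval φ s t :=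
      (hφ.lipschitzOnWith (s := uIcc s t)).absolutelyContinuousOnInterval
    have h3 := hac.integral_deriv_eq_sub
    have h4 : φ t - φ s = ‖v‖ * ‖v‖ := by
      simp only [φ]
      rw [← inner_sub_right, ← hv, real_inner_self_eq_norm_mul_norm]
    rw [← h4, ← h3, ← intervalIntegral.integral_const_mul]
    refine intervalIntegral.integral_mono_ae hst hac.intervalIntegrable_deriv (hint.const_mul _) ?_
    filter_upwards [hdiff] with r hr
    have h5 : deriv φ r = inner ℝ v (deriv g r) := by
      have := (hasDerivAt_const r v).inner ℝ hr.hasDerivAt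
      simpa using this.deriv
    rw [h5]
    exact real_inner_le_norm _ _
  have h2 : ‖v‖ ≤ ∫ r in s..t, ‖deriv g r‖ := by
    rcases (norm_nonneg v).eq_or_lt with h | h
    · rw [← h]
      exact intervalIntegral.integral_nonneg hst fun _ _ => norm_nonneg _
    · exact le_of_mul_le_mul_left h1 h
  rw [edist_dist, dist_eq_norm, ← hv]
  rw [intervalIntegral.integral_of_le hst] at h2
  rw [← ofReal_integral_eq_lintegral_ofReal]
  · exact ENNReal.ofReal_le_ofReal h2
  · exact (intervalIntegrable_iff_integrableOn_Ioc_of_le hst).1 hint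
  · exact Eventually.of_forall fun _ => norm_nonneg _

theorem unit_speed_of_variation {d : ℕ} {g : ℝ → Euc d} (hg : LipschitzWith 1 g) {ℓ : ℝ}
    (hv : ENNReal.ofReal ℓ ≤ eVariationOn g (Icc 0 ℓ)) :
    ∀ᵐ t ∂(volume.restrict (Icc (0 : ℝ) ℓ)), ‖deriv g t‖ = 1 := by
  have hb : ∀ r, ‖deriv g r‖ ≤ 1 := fun r => by simpa using norm_deriv_le_of_lipschitz hg (x₀ := r)
  have h1 : eVariationOn g (Icc 0 ℓ) ≤ ∫⁻ r in Icc 0 ℓ, ENNReal.ofReal ‖deriv g r‖ := by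
    refine iSup_le ?_
    rintro ⟨n, u, hu, hus⟩
    have hsub : ∀ i, Ioc (u i) (u (i+1)) ⊆ Icc 0 ℓ := fun i t ht =>
      ⟨(hus i).1.trans ht.1.le, ht.2.trans (hus (i+1)).2⟩
    calc _ ≤ ∑ i ∈ Finset.range n, ∫⁻ r in Ioc (u i) (u (i+1)), ENNReal.ofReal ‖deriv g r‖ :=
          Finset.sum_le_sum fun i _ => edist_le_lintegral_deriv hg (hu (Nat.le_succ i))
      _ = ∫⁻ r in ⋃ i ∈ Finset.range n, Ioc (u i) (u (i+1)), ENNReal.ofReal ‖deriv g r‖ := by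
          rw [lintegral_biUnion_finset]
          · intro i _ j _ hij
            exact hu.pairwise_disjoint_on_Ioc_succ hij
          · intro i _
            exact measurableSet_Ioc
      _ ≤ _ := lintegral_mono_set (iUnion₂_subset fun i _ => hsub i)
  have h2 := ae_eq_of_ae_le_of_lintegral_le (μ := volume.restrict (Icc (0:ℝ) ℓ))
    (f := fun r => ENNReal.ofReal ‖deriv g r‖) (g := fun _ => 1)
    (Eventually.of_forall fun r => ENNReal.ofReal_le_one.2 (hb r))
    (by
      refine ne_top_of_le_ne_top (b := ENNReal.ofReal ℓ) ENNReal.ofReal_ne_top ?_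
      calc _ ≤ ∫⁻ r in Icc 0 ℓ, 1 := lintegral_mono fun r => ENNReal.ofReal_le_one.2 (hb r)
        _ = _ := by simp)
    aemeasurable_const
    (by
      have := hv.trans h1
      simpa using this)
  filter_upwards [h2] with r hr
  have : ENNReal.ofReal ‖deriv g r‖ = 1 := hr
  exact ENNReal.ofReal_eq_one.1 this

/-- rectifiable simple arcs parametrized by arclength -/
structure IsArc {d : ℕ} (γ : ℝ → Euc d) (ℓ : ℝ) : Prop where
  nonneg : 0 ≤ ℓ
  lip : LipschitzWith 1 γ
  speed : ∀ᵐ t ∂(volume.restrict (Icc (0 : ℝ) ℓ)), ‖deriv γ t‖ = 1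
  hausd : ENNReal.ofReal ℓ ≤ μH[1] (γ '' Icc 0 ℓ)

theorem exists_arc {d : ℕ} {f : ℝ → Euc d} (hf : LipschitzWith 1 f) {L : ℝ} (hL : 0 ≤ L) :
    ∃ (γ : ℝ → Euc d) (ℓ : ℝ), IsArc γ ℓ ∧ γ 0 = f 0 ∧ γ ℓ = f L ∧
      γ '' Icc 0 ℓ ⊆ f '' Icc 0 L := by
  obtain ⟨ℓ, hℓ, ⟨g, hg, hgR, hg0, hgl⟩, hmin⟩ := exists_min_path
    (R := f '' Icc 0 L) (isCompact_Icc.image hf.continuous) hf hL (fun t ht => ⟨t, ht, rfl⟩)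
  have hv := min_path_variation hg hℓ hgR hg0 hgl hmin
  refine ⟨g, ℓ, ⟨hℓ, hg, unit_speed_of_variation hg hv,
    hv.trans (variation_le_hausd hg (min_path_inj hg hgR hg0 hgl hmin))⟩, hg0, hgl, ?_⟩
  rintro _ ⟨t, _, rfl⟩
  exact hgR t

theorem IsArc.map_le {d : ℕ} {γ : ℝ → Euc d} {ℓ : ℝ} (h : IsArc γ ℓ) :
    (volume.restrict (Icc 0 ℓ)).map γ ≤ (μH[1] : Measure (Euc d)).restrict (γ '' Icc 0 ℓ) := by
  have hm := h.lip.continuous.measurable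
  refine Measure.le_iff.2 fun B hB => ?_
  have h1 := hausd_restrict_le_map h.lip 0 ℓ Bᶜ
  have h2 : ((volume.restrict (Icc 0 ℓ)).map γ) Bᶜ ≠ ⊤ := by
    rw [Measure.map_apply hm hB.compl]
    exact measure_ne_top _ _
  have h3 : (volume.restrict (Icc 0 ℓ)).map γ B + (volume.restrict (Icc 0 ℓ)).map γ Bᶜ
      = ENNReal.ofReal ℓ := by
    rw [measure_add_measure_compl hB, Measure.map_apply hm MeasurableSet.univ]
    simp
  have h4 : (μH[1] : Measure (Euc d)).restrict (γ '' Icc 0 ℓ) B +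
      (μH[1] : Measure (Euc d)).restrict (γ '' Icc 0 ℓ) Bᶜ = μH[1] (γ '' Icc 0 ℓ) := by
    rw [measure_add_measure_compl hB, Measure.restrict_apply_univ]
  refine (ENNReal.add_le_add_iff_right h2).1 ?_
  rw [h3]
  refine h.hausd.trans ?_
  rw [← h4]
  gcongr

theorem IsArc.lintegral_le {d : ℕ} {γ : ℝ → Euc d} {ℓ : ℝ} (h : IsArc γ ℓ)
    {w : Euc d → ℝ≥0∞} (hw : Measurable w) :
    ∫⁻ t in Icc 0 ℓ, w (γ t) ≤ ∫⁻ x in γ '' Icc 0 ℓ, w x ∂μH[1] := by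
  rw [← lintegral_map hw h.lip.continuous.measurable]
  exact lintegral_mono' h.map_le le_rfl

theorem meas_int {a b : ℝ → ℝ} (ha : Measurable a) (hb : Measurable b) {F : ℝ → ℝ → ℝ≥0∞}
    (hF : Measurable (Function.uncurry F)) :
    Measurable fun θ => ∫⁻ t in Icc (a θ) (b θ), F θ t := by
  have hS : MeasurableSet {p : ℝ × ℝ | a p.1 ≤ p.2 ∧ p.2 ≤ b p.1} :=
    (measurableSet_le (ha.comp measurable_fst) measurable_snd).inter
      (measurableSet_le measurable_snd (hb.comp measurable_fst))
  have h := (hF.indicator hS).lintegral_prod_right' (ν := (volume : Measure ℝ))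
  convert h using 2 with θ
  rw [← lintegral_indicator measurableSet_Icc]
  rfl

/-- cleaned-up plans -/
structure Clean (d : ℕ) where
  X : ℝ → ℝ → Euc d
  T : ℝ → ℝ
  M : ℝ
  meas : Measurable (Function.uncurry X)
  T0 : ∀ θ, 0 ≤ T θ
  lip : ∀ θ, LipschitzWith 1 (X θ)
  unit : ∀ θ, ∀ᵐ t ∂(volume.restrict (Icc (0 : ℝ) (T θ))), ‖deriv (X θ) t‖ = 1
  halts : ∀ θ t, T θ ≤ t → X θ t = X θ (T θ)
  start : ∀ θ, X θ 0 = 0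

namespace Clean
variable {d : ℕ} (P : Clean d)

def ν : Measure ℝ := volume.restrict (Icc 0 P.M)

instance : IsFiniteMeasure P.ν := by unfold ν; infer_instance

theorem measX (t : ℝ) : Measurable fun θ => P.X θ t :=
  P.meas.comp (measurable_id.prodMk measurable_const)

theorem T_le_iff (c : ℝ) (hc : 0 ≤ c) (θ : ℝ) :
    P.T θ ≤ c ↔ ∀ q : ℚ, c ≤ q → P.X θ q = P.X θ c := by
  constructor
  · intro h q hq
    rw [P.halts θ q (h.trans hq), P.halts θ c h]
  · intro h
    by_contra hlt
    push Not at hlt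
    have hcst : ∀ t, c < t → P.X θ t = P.X θ c := by
      intro t ht
      by_contra hne
      have hop : IsOpen {s | P.X θ s ≠ P.X θ c} :=
        isOpen_ne_fun (P.lip θ).continuous continuous_const
      obtain ⟨q, hq⟩ := Rat.denseRange_cast.exists_mem_open (hop.inter isOpen_Ioi) ⟨t, hne, ht⟩
      exact hq.1 (h q (le_of_lt hq.2))
    have hu := P.unit θ
    have hd : ∀ t ∈ Ioo c (P.T θ), deriv (P.X θ) t = 0 := by
      intro t ht
      have : P.X θ =ᶠ[𝓝 t] fun _ => P.X θ c := by
        filter_upwards [Ioi_mem_nhds ht.1] with s hs using hcst s hs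
      rw [this.deriv_eq, deriv_const]
    rw [ae_restrict_iff' measurableSet_Icc] at hu
    have h0 : volume (Ioo c (P.T θ)) = 0 := by
      refine measure_mono_null ?_ hu
      intro t ht h3
      have := h3 ⟨hc.trans ht.1.le, ht.2.le⟩
      rw [hd t ht] at this
      simp at this
    rw [Real.volume_Ioo] at h0
    have := ENNReal.ofReal_eq_zero.1 h0
    linarith

theorem measT : Measurable P.T := by
  refine measurable_of_Iic fun c => ?_
  by_cases hc : 0 ≤ c
  · have : P.T ⁻¹' Iic c = ⋂ q : ℚ, ⋂ (_ : c ≤ q), {θ | P.X θ q = P.X θ c} := by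
      ext θ
      simp only [mem_preimage, mem_Iic, mem_iInter, P.T_le_iff c hc θ]
      rfl
    rw [this]
    exact MeasurableSet.iInter fun q => MeasurableSet.iInter fun _ =>
      measurableSet_eq_fun (P.measX _) (P.measX _)
  · have : P.T ⁻¹' Iic c = ∅ := by
      ext θ
      simp only [mem_preimage, mem_Iic, mem_empty_iff_false, iff_false, not_le]
      exact lt_of_lt_of_le (not_le.1 hc) (P.T0 θ)
    rw [this]; exact MeasurableSet.empty

theorem measXf {σ : ℝ → ℝ} (hσ : Measurable σ) : Measurable fun θ => P.X θ (σ θ) :=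
  P.meas.comp (measurable_id.prodMk hσ)

def pt (θ : ℝ) : Euc d := P.X θ (P.T θ)

theorem meas_pt : Measurable P.pt := P.measXf P.measT

def hit (p : ℝ) (x : Euc d) : Set ℝ := {θ | ∃ t, p ≤ t ∧ P.X θ t = x}

theorem hit_tail (p θ : ℝ) : {x | ∃ t, p ≤ t ∧ P.X θ t = x} = P.X θ '' Icc p (max p (P.T θ)) := by
  ext x
  constructor
  · rintro ⟨t, ht, rfl⟩
    by_cases h : t ≤ max p (P.T θ)
    · exact ⟨t, ⟨ht, h⟩, rfl⟩
    · refine ⟨max p (P.T θ), ⟨le_max_left _ _, le_rfl⟩, ?_⟩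
      rw [P.halts θ t ((le_max_right _ _).trans (not_le.1 h).le), P.halts θ _ (le_max_right _ _)]
  · rintro ⟨t, ht, rfl⟩
    exact ⟨t, ht.1, rfl⟩

theorem meas_hit (p : ℝ) : MeasurableSet {q : ℝ × Euc d | q.1 ∈ P.hit p q.2} := by
  have : {q : ℝ × Euc d | q.1 ∈ P.hit p q.2} =
      ⋂ n : ℕ, ⋃ r : ℚ, ⋃ (_ : p ≤ r), {q : ℝ × Euc d | dist (P.X q.1 r) q.2 < 1 / ((n:ℝ)+1)} := by
    ext ⟨θ, x⟩
    constructor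
    · rintro ⟨t, ht, hx⟩
      refine mem_iInter.2 fun n => ?_
      obtain ⟨r, hr1, hr2⟩ := exists_rat_btwn (show t < t + 1 / ((n:ℝ)+1) by
        have : (0:ℝ) < 1 / ((n:ℝ)+1) := by positivity
        linarith)
      refine mem_iUnion.2 ⟨r, mem_iUnion.2 ⟨ht.trans hr1.le, ?_⟩⟩
      change dist (P.X θ r) x < _
      simp only at hx
      rw [← hx]
      refine ((P.lip θ).dist_le_mul _ _).trans_lt ?_
      rw [NNReal.coe_one, one_mul, Real.dist_eq, abs_of_pos (by linarith)]
      linarith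
    · intro h
      have hcl : x ∈ closure {x | ∃ t, p ≤ t ∧ P.X θ t = x} := by
        refine Metric.mem_closure_iff.2 fun ε hε => ?_
        obtain ⟨n, hn⟩ := exists_nat_one_div_lt hε
        have := mem_iInter.1 h n
        obtain ⟨r, hr⟩ := mem_iUnion.1 this
        obtain ⟨hr, hd⟩ := mem_iUnion.1 hr
        refine ⟨P.X θ r, ⟨r, hr, rfl⟩, ?_⟩
        rw [dist_comm]
        exact lt_trans hd hn
      rw [P.hit_tail] at hcl
      rw [((isCompact_Icc.image (P.lip θ).continuous).isClosed).closure_eq, ← P.hit_tail] at hcl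
      exact hcl
  rw [this]
  refine MeasurableSet.iInter fun n => MeasurableSet.iUnion fun r => MeasurableSet.iUnion fun _ => ?_
  exact measurableSet_lt (((P.measX r).comp measurable_fst).dist measurable_snd) measurable_const

theorem meas_hit' (p : ℝ) (x : Euc d) : MeasurableSet (P.hit p x) :=
  measurable_prodMk_right (P.meas_hit p)

def mult (x : Euc d) : ℝ≥0∞ := P.ν (P.hit 0 x)

theorem meas_multB (p : ℝ) {B : Set ℝ} (hB : MeasurableSet B) :
    Measurable fun x => P.ν (B ∩ P.hit p x) := by
  have h : MeasurableSet ((Prod.fst ⁻¹' B) ∩ {q : ℝ × Euc d | q.1 ∈ P.hit p q.2}) :=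
    (measurable_fst hB).inter (P.meas_hit p)
  exact measurable_measure_prodMk_right h

theorem meas_mult : Measurable P.mult := by
  have := P.meas_multB 0 MeasurableSet.univ
  simp only [univ_inter] at this
  exact this

def w (α : ℝ) (x : Euc d) : ℝ≥0∞ := P.mult x ^ (α - 1)

theorem meas_w (α : ℝ) : Measurable (P.w α) := P.meas_mult.pow_const _

theorem mult_le (x : Euc d) : P.mult x ≤ ENNReal.ofReal P.M := by
  refine (measure_mono (subset_univ _)).trans ?_
  simp [ν]

theorem meas_wX (α : ℝ) : Measurable (Function.uncurry fun θ t => P.w α (P.X θ t)) :=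
  (P.meas_w α).comp P.meas

def C (α : ℝ) (θ : ℝ) : ℝ≥0∞ := ∫⁻ t in Icc 0 (P.T θ), P.w α (P.X θ t)

theorem meas_C (α : ℝ) : Measurable (P.C α) := meas_int measurable_const P.measT (P.meas_wX α)

def E (α : ℝ) : ℝ≥0∞ := ∫⁻ θ, P.C α θ ∂P.ν

theorem mult_pos_of_w {α : ℝ} (hα : α < 1) {x : Euc d} (h : P.w α x ≠ ⊤) : 0 < P.mult x := by
  rw [pos_iff_ne_zero]
  intro h0
  apply h
  rw [w, h0, ENNReal.zero_rpow_of_neg (by linarith)]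

theorem ae_mult_pos {α : ℝ} (hα : α < 1) {θ : ℝ} (h : P.C α θ ≠ ⊤) :
    ∀ᵐ t ∂(volume.restrict (Icc 0 (P.T θ))), 0 < P.mult (P.X θ t) := by
  have := ae_lt_top ((P.meas_w α).comp ((P.lip θ).continuous.measurable)) h
  filter_upwards [this] with t ht
  exact P.mult_pos_of_w hα ht.ne

theorem ae_C_lt_top {α : ℝ} (h : P.E α ≠ ⊤) : ∀ᵐ θ ∂P.ν, P.C α θ < ⊤ :=
  ae_lt_top (P.meas_C α) h

end Clean

/-- the cleaned version of a plan -/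
def IrrigationPlan.clean {d : ℕ} {μ : Measure (Euc d)} (χ : IrrigationPlan μ) : Clean d where
  X := fun θ t => by
    classical exact if θ ∈ Icc (0 : ℝ) (μ univ).toReal then χ.toFun θ t else 0
  T := fun θ => by
    classical exact if θ ∈ Icc (0 : ℝ) (μ univ).toReal then χ.T θ else 0
  M := (μ univ).toReal
  meas := by
    classical
    exact Measurable.ite (measurable_fst measurableSet_Icc) χ.measurable measurable_const
  T0 := fun θ => by
    split_ifs
    · exact χ.T_nonneg θ
    · exact le_rfl
  lip := fun θ => by
    by_cases h : θ ∈ Icc (0 : ℝ) (μ univ).toReal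
    · simp only [if_pos h]; exact χ.lipschitz θ h
    · simp only [if_neg h]; exact LipschitzWith.const' _
  unit := fun θ => by
    by_cases h : θ ∈ Icc (0 : ℝ) (μ univ).toReal
    · simp only [if_pos h]; exact χ.unit_speed θ h
    · simp only [if_neg h, Icc_self]
      rw [Measure.restrict_eq_zero.2 (by simp)]
      simp
  halts := fun θ t => by
    by_cases h : θ ∈ Icc (0 : ℝ) (μ univ).toReal
    · simp only [if_pos h]; exact χ.stopped θ h t
    · simp only [if_neg h]; try exact fun _ => trivial
  start := fun θ => by
    by_cases h : θ ∈ Icc (0 : ℝ) (μ univ).toReal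
    · simp only [if_pos h]; exact χ.start θ h
    · simp only [if_neg h]; try exact fun _ => trivial

section
variable {d : ℕ} {μ : Measure (Euc d)} (χ : IrrigationPlan μ)

theorem clean_X {θ : ℝ} (h : θ ∈ Icc (0 : ℝ) (μ univ).toReal) : χ.clean.X θ = χ.toFun θ := by
  funext t
  simp only [IrrigationPlan.clean, if_pos h]

theorem clean_T {θ : ℝ} (h : θ ∈ Icc (0 : ℝ) (μ univ).toReal) : χ.clean.T θ = χ.T θ := by
  simp only [IrrigationPlan.clean, if_pos h]

theorem clean_mult (x : Euc d) : χ.clean.mult x = χ.mult x := by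
  unfold Clean.mult Clean.ν IrrigationPlan.mult
  rw [Measure.restrict_apply' measurableSet_Icc]
  congr 1
  ext θ
  constructor
  · rintro ⟨⟨t, h1, h2⟩, h⟩
    exact ⟨h, t, h1, by rw [clean_X χ h] at h2; exact h2⟩
  · rintro ⟨h, t, h1, h2⟩
    exact ⟨⟨t, h1, by rw [clean_X χ h]; exact h2⟩, h⟩

theorem clean_inner (α : ℝ) {θ : ℝ} (h : θ ∈ Icc (0 : ℝ) (μ univ).toReal) :
    ∫⁻ t in Ici (0 : ℝ), χ.mult (χ.toFun θ t) ^ (α - 1) * ENNReal.ofReal ‖deriv (χ.toFun θ) t‖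
      = χ.clean.C α θ := by
  have h0 := χ.clean.T0 θ
  have e : Ici (0:ℝ) = Icc 0 (χ.clean.T θ) ∪ Ioi (χ.clean.T θ) := (Icc_union_Ioi_eq_Ici h0).symm
  have hdis : Disjoint (Icc 0 (χ.clean.T θ)) (Ioi (χ.clean.T θ)) := by
    rw [Set.disjoint_left]; intro x hx hx'; exact absurd hx.2 (not_le.2 hx')
  rw [← clean_X χ h, e, lintegral_union measurableSet_Ioi hdis]
  have h2 : ∫⁻ t in Ioi (χ.clean.T θ), χ.mult (χ.clean.X θ t) ^ (α - 1) *
      ENNReal.ofReal ‖deriv (χ.clean.X θ) t‖ = 0 := by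
    rw [setLIntegral_congr_fun (g := fun _ => 0) measurableSet_Ioi]
    · simp
    · intro t ht
      have : χ.clean.X θ =ᶠ[𝓝 t] fun _ => χ.clean.X θ (χ.clean.T θ) := by
        filter_upwards [Ioi_mem_nhds ht] with s hs using χ.clean.halts θ s (le_of_lt hs)
      simp only
      rw [this.deriv_eq, deriv_const]
      simp
  rw [h2, add_zero, Clean.C]
  refine lintegral_congr_ae ?_
  filter_upwards [χ.clean.unit θ] with t ht
  rw [ht, Clean.w, clean_mult]
  simp

theorem clean_cost (α : ℝ) : χ.cost α = χ.clean.E α := by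
  unfold IrrigationPlan.cost Clean.E
  exact setLIntegral_congr_fun measurableSet_Icc fun θ h => clean_inner χ α h

theorem clean_map : (χ.clean.ν).map χ.clean.pt = μ := by
  conv_rhs => rw [← χ.irrigates]
  refine Measure.map_congr ?_
  change ∀ᵐ θ ∂volume.restrict (Icc (0 : ℝ) (μ univ).toReal), _
  filter_upwards [ae_restrict_mem measurableSet_Icc] with θ h
  rw [Clean.pt, clean_X χ h, clean_T χ h]

end

namespace Clean
variable {d : ℕ} (P : Clean d)

theorem exhaust (p : ℝ) (V : Set (Euc d)) : ∃ D : Set (Euc d), D.Countable ∧ D ⊆ V ∧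
    ∀ x ∈ V, P.ν ((⋃ d ∈ D, P.hit p d)ᶜ ∩ P.hit p x) = 0 := by
  let F : Set (Euc d) → ℝ≥0∞ := fun D => P.ν (⋃ d ∈ D, P.hit p d)
  let S : Set ℝ≥0∞ := F '' {D | D.Countable ∧ D ⊆ V}
  have hne : S.Nonempty := ⟨F ∅, ∅, ⟨countable_empty, empty_subset _⟩, rfl⟩
  obtain ⟨u, _, hu, huS⟩ := exists_seq_tendsto_sSup hne (OrderTop.bddAbove S)
  choose Dn hDn hF using huS
  set D := ⋃ n, Dn n with hD
  have hDc : D.Countable := countable_iUnion fun n => (hDn n).1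
  have hDV : D ⊆ V := iUnion_subset fun n => (hDn n).2
  have hmono : ∀ D1 D2 : Set (Euc d), D1 ⊆ D2 → F D1 ≤ F D2 := fun D1 D2 h =>
    measure_mono (biUnion_subset_biUnion_left h)
  have h1 : sSup S ≤ F D := le_of_tendsto' hu fun n => by
    rw [← hF n]; exact hmono _ _ (subset_iUnion _ n)
  refine ⟨D, hDc, hDV, fun x hx => ?_⟩
  have h2 : F (insert x D) ≤ F D := by
    exact le_trans (le_sSup (mem_image_of_mem F (show insert x D ∈ {D | D.Countable ∧ D ⊆ V} from
      ⟨hDc.insert x, insert_subset hx hDV⟩))) h1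
  have hm : MeasurableSet (⋃ d ∈ D, P.hit p d) := MeasurableSet.biUnion hDc fun d _ => P.meas_hit' p d
  have h3 : F (insert x D) = F D + P.ν ((⋃ d ∈ D, P.hit p d)ᶜ ∩ P.hit p x) := by
    simp only [F]
    rw [biUnion_insert, ← measure_inter_add_sdiff (P.hit p x ∪ ⋃ d ∈ D, P.hit p d) hm]
    congr 1
    · congr 1; exact inter_eq_right.2 subset_union_right
    · congr 1; ext θ; simp only [Set.mem_sdiff, mem_union, mem_inter_iff, mem_compl_iff]; tauto
  rw [h3] at h2
  have h4 : F D + P.ν ((⋃ d ∈ D, P.hit p d)ᶜ ∩ P.hit p x) ≤ F D + 0 := by simpa using h2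
  have h5 := (ENNReal.add_le_add_iff_left (measure_ne_top P.ν _)).1 h4
  exact le_antisymm h5 (zero_le)

theorem D_lemma {α : ℝ} (hα : α < 1) (hE : P.E α ≠ ⊤) {p : ℝ} (hp : 0 ≤ p) {V : Set (Euc d)}
    (hV : MeasurableSet V) : ∃ D : Set (Euc d), D.Countable ∧ D ⊆ V ∧
      ∀ᵐ θ ∂P.ν, volume (Icc p (P.T θ) ∩ P.X θ ⁻¹' V) ≠ 0 → ∃ x ∈ D, θ ∈ P.hit p x := by
  obtain ⟨D, hDc, hDV, hD⟩ := P.exhaust p V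
  refine ⟨D, hDc, hDV, ?_⟩
  set U := ⋃ d ∈ D, P.hit p d with hU
  have hUm : MeasurableSet U := MeasurableSet.biUnion hDc fun d _ => P.meas_hit' p d
  -- step 1
  have s1 : ∀ θ, ∀ᵐ θ' ∂(P.ν.restrict Uᶜ), ∀ᵐ t ∂(volume.restrict (Icc 0 (P.T θ))),
      ¬ (P.X θ t ∈ V ∧ θ' ∈ P.hit p (P.X θ t)) := by
    intro θ
    rw [Measure.ae_ae_comm]
    · refine Eventually.of_forall fun t => ?_
      rw [ae_restrict_iff' hUm.compl]
      by_cases hx : P.X θ t ∈ V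
      · have := hD _ hx
        rw [measure_eq_zero_iff_ae_notMem] at this
        filter_upwards [this] with θ' h1 h2 h3
        exact h1 ⟨h2, h3.2⟩
      · exact Eventually.of_forall fun θ' _ h => hx h.1
    · have hX : Measurable fun x : ℝ × ℝ => P.X θ x.2 :=
        (P.lip θ).continuous.measurable.comp measurable_snd
      exact ((hX hV).inter ((measurable_fst.prodMk hX) (P.meas_hit p))).compl
  let K : Set ((ℝ × ℝ) × ℝ) := {q | (p ≤ q.2 ∧ q.2 ≤ P.T q.1.2) ∧ P.X q.1.2 q.2 ∈ V ∧
    q.1.1 ∈ P.hit 0 (P.X q.1.2 q.2)}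
  have hK : MeasurableSet K := by
    have hX : Measurable fun q : (ℝ × ℝ) × ℝ => P.X q.1.2 q.2 :=
      P.meas.comp ((measurable_snd.comp measurable_fst).prodMk measurable_snd)
    refine MeasurableSet.inter ?_ ((hX hV).inter
      (((measurable_fst.comp measurable_fst).prodMk hX) (P.meas_hit 0)))
    exact (measurableSet_le measurable_const measurable_snd).inter
      (measurableSet_le measurable_snd (P.measT.comp (measurable_snd.comp measurable_fst)))
  have s2 : ∀ θ, ∀ᵐ θ' ∂(P.ν.restrict Uᶜ), ∀ᵐ s : ℝ, ((θ, θ'), s) ∉ K := by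
    intro θ
    filter_upwards [s1 θ] with θ' h
    rw [ae_restrict_iff' measurableSet_Icc] at h
    have hN0 : volume {t | ¬ (t ∈ Icc 0 (P.T θ) → ¬ (P.X θ t ∈ V ∧ θ' ∈ P.hit p (P.X θ t)))} = 0 := h
    have hN := le_antisymm ((hausd_image_le (P.lip θ) _).trans hN0.le) (zero_le)
    have h5 := null_preimage (P.unit θ') measurableSet_Icc hN
    rw [measure_eq_zero_iff_ae_notMem] at h5
    filter_upwards [h5] with s hs
    rintro ⟨⟨h1, h2⟩, h3, h4⟩
    apply hs
    simp only at h1 h2 h3 h4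
    refine ⟨⟨hp.trans h1, h2⟩, ?_⟩
    have h6 : P.X θ' s ∈ {x | ∃ t, 0 ≤ t ∧ P.X θ t = x} := h4
    rw [P.hit_tail 0 θ, max_eq_right (P.T0 θ)] at h6
    obtain ⟨t, ht, hts⟩ := h6
    refine ⟨t, ?_, hts⟩
    intro hcon
    refine hcon ht ⟨?_, ?_⟩
    · rw [hts]; exact h3
    · rw [hts]; exact ⟨s, h1, rfl⟩
  have s3 : ∀ᵐ θ' ∂(P.ν.restrict Uᶜ), ∀ᵐ θ ∂P.ν, ∀ᵐ s : ℝ, ((θ, θ'), s) ∉ K := by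
    have := (Measure.ae_ae_comm (μ := P.ν) (ν := P.ν.restrict Uᶜ)
      (p := fun θ θ' => ∀ᵐ s : ℝ, ((θ, θ'), s) ∉ K) ?_).1 (Eventually.of_forall s2)
    · exact this
    · have h1 : Measurable fun q : ℝ × ℝ => volume (Prod.mk q ⁻¹' K) := measurable_measure_prodMk_left hK
      have h2 := h1 (measurableSet_singleton 0)
      convert h2 using 1
      ext q
      simp only [mem_preimage, mem_singleton_iff]
      rw [measure_eq_zero_iff_ae_notMem]
      rfl
  rw [ae_restrict_iff' hUm.compl] at s3
  filter_upwards [s3, P.ae_C_lt_top hE] with θ' h3 hC hvol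
  by_contra hcon
  have hθ : θ' ∈ Uᶜ := by
    intro hin
    rw [hU] at hin
    simp only [mem_iUnion, exists_prop] at hin
    exact hcon hin
  have h4 := h3 hθ
  rw [Measure.ae_ae_comm] at h4
  · apply hvol
    have h5 := P.ae_mult_pos hα hC.ne
    rw [ae_restrict_iff' measurableSet_Icc] at h5
    rw [measure_eq_zero_iff_ae_notMem]
    filter_upwards [h4, h5] with s h4 h5
    rintro ⟨h6, h7⟩
    have h8 := h5 ⟨hp.trans h6.1, h6.2⟩
    refine h8.ne' ?_
    rw [mult, measure_eq_zero_iff_ae_notMem]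
    filter_upwards [h4] with θ h9 h10
    exact h9 ⟨h6, h7, h10⟩
  · have : Measurable fun x : ℝ × ℝ => (((x.1, θ'), x.2) : (ℝ × ℝ) × ℝ) :=
      (measurable_fst.prodMk measurable_const).prodMk measurable_snd
    exact (this hK).compl

end Clean

/-- weighted pseudo-distance -/
def Vd {d : ℕ} (w : Euc d → ℝ≥0∞) (x y : Euc d) : ℝ≥0∞ :=
  ⨅ (f : ℝ → Euc d) (L : ℝ) (_ : LipschitzWith 1 f) (_ : 0 ≤ L) (_ : f 0 = x) (_ : f L = y),
    ∫⁻ t in Icc 0 L, w (f t)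

section
variable {d : ℕ} {w : Euc d → ℝ≥0∞}

theorem Vd_lt_iff {x y : Euc d} {c : ℝ≥0∞} : Vd w x y < c ↔ ∃ (f : ℝ → Euc d) (L : ℝ),
    LipschitzWith 1 f ∧ 0 ≤ L ∧ f 0 = x ∧ f L = y ∧ ∫⁻ t in Icc 0 L, w (f t) < c := by
  simp only [Vd, iInf_lt_iff, exists_prop]

theorem Vd_le {f : ℝ → Euc d} {L : ℝ} (hf : LipschitzWith 1 f) (hL : 0 ≤ L) :
    Vd w (f 0) (f L) ≤ ∫⁻ t in Icc 0 L, w (f t) := by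
  refine iInf_le_of_le f <| iInf_le_of_le L <| iInf_le_of_le hf <| iInf_le_of_le hL <|
    iInf_le_of_le rfl <| iInf_le_of_le rfl le_rfl

theorem lintegral_shift (F : ℝ → ℝ≥0∞) (a b c : ℝ) :
    ∫⁻ t in Icc a b, F (c + t) = ∫⁻ t in Icc (c + a) (c + b), F t := by
  have h := (measurePreserving_add_left volume c).setLIntegral_comp_preimage_emb
    (measurableEmbedding_addLeft c) F (Icc (c + a) (c + b))
  rw [← h]
  congr 2
  ext t; simp

theorem Vd_le_of {f : ℝ → Euc d} {a b : ℝ} (hf : LipschitzWith 1 f) (hab : a ≤ b) :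
    Vd w (f a) (f b) ≤ ∫⁻ t in Icc a b, w (f t) := by
  have h1 : LipschitzWith 1 (fun t => f (a + t)) := by
    refine LipschitzWith.of_dist_le_mul fun s t => ?_
    have := hf.dist_le_mul (a + s) (a + t)
    simpa using this
  have h := Vd_le (w := w) h1 (sub_nonneg.2 hab)
  rw [lintegral_shift (fun t => w (f t))] at h
  simpa using h

theorem Vd_symm_le (x y : Euc d) : Vd w x y ≤ Vd w y x := by
  refine le_of_forall_gt fun c hc => ?_
  obtain ⟨f, L, hf, hL, h0, h1, hlt⟩ := Vd_lt_iff.1 hc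
  refine Vd_lt_iff.2 ⟨fun t => f (L - t), L, ?_, hL, by simpa using h1, by simpa using h0, ?_⟩
  · refine LipschitzWith.of_dist_le_mul fun s t => ?_
    have := hf.dist_le_mul (L - s) (L - t)
    rwa [dist_sub_left] at this
  · have h := (Measure.measurePreserving_sub_left volume L).setLIntegral_comp_preimage_emb
      (Homeomorph.subLeft L).measurableEmbedding (fun t => w (f t)) (Icc 0 L)
    have e : (fun t => L - t) ⁻¹' Icc 0 L = Icc 0 L := by
      ext t; simp only [mem_preimage, mem_Icc]; constructor <;> rintro ⟨h1, h2⟩ <;> constructor <;> linarith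
    rw [e] at h
    rw [h]
    exact hlt

theorem Vd_triangle (x y z : Euc d) : Vd w x z ≤ Vd w x y + Vd w y z := by
  by_cases ht : Vd w x y + Vd w y z = ⊤
  · rw [ht]; exact le_top
  rw [ENNReal.add_eq_top, not_or] at ht
  refine ENNReal.le_of_forall_pos_le_add fun ε hε _ => ?_
  have hε2 : (ε : ℝ≥0∞) / 2 ≠ 0 := by simp [hε.ne']
  obtain ⟨f, L, hf, hL, hf0, hfL, hfc⟩ := Vd_lt_iff.1 (ENNReal.lt_add_right ht.1 hε2)
  obtain ⟨g, K, hg, hK, hg0, hgK, hgc⟩ := Vd_lt_iff.1 (ENNReal.lt_add_right ht.2 hε2)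
  let h : ℝ → Euc d := fun t => f (min t L) + g (max t L - L) - y
  have aux : ∀ a b, a ≤ b → dist (h a) (h b) ≤ b - a := by
    intro a b hab
    have e1 := hf.dist_le_mul (min a L) (min b L)
    have e2 := hg.dist_le_mul (max a L - L) (max b L - L)
    have e3 := dist_add_add_le (f (min a L)) (g (max a L - L)) (f (min b L)) (g (max b L - L))
    simp only [h]
    rw [dist_sub_right]
    simp only [NNReal.coe_one, one_mul, Real.dist_eq] at e1 e2
    rw [abs_sub_comm, abs_of_nonneg (by linarith [min_le_min_right L hab])] at e1
    rw [abs_sub_comm, abs_of_nonneg (by linarith [max_le_max_right L hab])] at e2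
    have h4 := min_add_max a L
    have h5 := min_add_max b L
    linarith
  have hh : LipschitzWith 1 h := by
    refine LipschitzWith.of_dist_le_mul fun a b => ?_
    simp only [NNReal.coe_one, one_mul, Real.dist_eq a b]
    rcases le_total a b with h | h
    · rw [abs_sub_comm, abs_of_nonneg (by linarith)]; exact aux a b h
    · rw [abs_of_nonneg (by linarith), dist_comm]; exact aux b a h
  have hl : ∀ t, t ≤ L → h t = f t := fun t ht => by
    simp only [h, min_eq_left ht, max_eq_right ht, sub_self, hg0]; simp
  have hr : ∀ t, L ≤ t → h t = g (t - L) := fun t ht => by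
    simp only [h, min_eq_right ht, max_eq_left ht, hfL]; simp
  have h0 : h 0 = x := by rw [hl 0 hL, hf0]
  have h1 : h (L + K) = z := by rw [hr _ (by linarith)]; simpa using hgK
  have hV := Vd_le (w := w) hh (show 0 ≤ L + K by linarith)
  rw [h0, h1] at hV
  refine hV.trans ?_
  have hu : Icc 0 (L + K) = Icc 0 L ∪ Icc L (L + K) := (Icc_union_Icc_eq_Icc hL (by linarith)).symm
  rw [hu]
  refine (lintegral_union_le _ _ _).trans ?_
  have i1 : ∫⁻ t in Icc 0 L, w (h t) = ∫⁻ t in Icc 0 L, w (f t) :=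
    setLIntegral_congr_fun measurableSet_Icc fun t ht => by simp only [hl t ht.2]
  have i2 : ∫⁻ t in Icc L (L + K), w (h t) = ∫⁻ t in Icc 0 K, w (g t) := by
    have := lintegral_shift (fun t => w (h t)) 0 K L
    rw [add_zero] at this
    rw [← this]
    exact setLIntegral_congr_fun measurableSet_Icc fun t ht => by
      rw [hr _ (by linarith [ht.1])]; simp
  rw [i1, i2]
  calc _ ≤ (Vd w x y + ε / 2) + (Vd w y z + ε / 2) := add_le_add hfc.le hgc.le
    _ = _ := by rw [add_add_add_comm, ENNReal.add_halves]

theorem Vd_exists_arc (hw : Measurable w) {x y : Euc d} {c : ℝ≥0∞} (h : Vd w x y < c) :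
    ∃ (γ : ℝ → Euc d) (ℓ : ℝ), IsArc γ ℓ ∧ γ 0 = x ∧ γ ℓ = y ∧ ∫⁻ t in Icc 0 ℓ, w (γ t) < c := by
  obtain ⟨f, L, hf, hL, h0, h1, hlt⟩ := Vd_lt_iff.1 h
  obtain ⟨γ, ℓ, hγ, hγ0, hγl, hsub⟩ := exists_arc hf hL
  refine ⟨γ, ℓ, hγ, hγ0.trans h0, hγl.trans h1, lt_of_le_of_lt ?_ hlt⟩
  exact (hγ.lintegral_le hw).trans ((lintegral_mono_set hsub).trans (lintegral_image_le hf 0 L hw))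

theorem Vd_ge {b : ℝ≥0∞} (hb : ∀ x, b ≤ w x) (x y : Euc d) : b * edist x y ≤ Vd w x y := by
  refine le_iInf fun f => le_iInf fun L => le_iInf fun hf => le_iInf fun hL => le_iInf fun h0 =>
    le_iInf fun h1 => ?_
  calc b * edist x y ≤ b * ENNReal.ofReal L := by
        gcongr
        rw [← h0, ← h1, edist_dist]
        refine ENNReal.ofReal_le_ofReal ?_
        have := hf.dist_le_mul 0 L
        simpa [abs_of_nonneg hL] using this
    _ = ∫⁻ t in Icc 0 L, b := by simp
    _ ≤ _ := lintegral_mono fun t => hb _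

/-- any two points are joined by an arc -/
theorem exists_arc_any (x y : Euc d) : ∃ (γ : ℝ → Euc d) (ℓ : ℝ), IsArc γ ℓ ∧ γ 0 = x ∧ γ ℓ = y := by
  have h : Vd (fun _ : Euc d => (0 : ℝ≥0∞)) x y < ⊤ := by
    by_cases hxy : x = y
    · refine Vd_lt_iff.2 ⟨fun _ => x, 0, LipschitzWith.const' _, le_rfl, rfl, hxy, by simp⟩
    · have hn : ‖y - x‖ ≠ 0 := by rw [norm_ne_zero_iff, sub_ne_zero]; exact fun h => hxy h.symm
      refine Vd_lt_iff.2 ⟨fun t => x + (t / ‖y - x‖) • (y - x), ‖y - x‖, ?_, norm_nonneg _, by simp, ?_, by simp⟩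
      · refine LipschitzWith.of_dist_le_mul fun s t => ?_
        rw [dist_add_left, dist_eq_norm, ← sub_smul, norm_smul, ← sub_div, norm_div, norm_norm,
          div_mul_cancel₀ _ hn, NNReal.coe_one, one_mul, dist_eq_norm]
      · simp only [div_self hn]; simp
  obtain ⟨γ, ℓ, h1, h2, h3, _⟩ := Vd_exists_arc measurable_const h
  exact ⟨γ, ℓ, h1, h2, h3⟩

end

/-- partial sums -/
def SS (l : ℕ → ℝ) (k : ℕ) : ℝ := ∑ j ∈ Finset.range k, l j
/-- clamped local time -/
def cc (l : ℕ → ℝ) (k : ℕ) (t : ℝ) : ℝ := max 0 (min (t - SS l k) (l k))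
/-- concatenated path -/
def PX {d : ℕ} (g : ℕ → ℝ → Euc d) (l : ℕ → ℝ) (t : ℝ) : Euc d := ∑' k, (g k (cc l k t) - g k 0)

section
variable {d : ℕ} {g : ℕ → ℝ → Euc d} {l : ℕ → ℝ}

theorem SS_succ (l : ℕ → ℝ) (k : ℕ) : SS l (k+1) = SS l k + l k := Finset.sum_range_succ _ _

theorem SS_mono (hl : ∀ k, 0 ≤ l k) : Monotone (SS l) :=
  monotone_nat_of_le_succ fun k => by rw [SS_succ]; linarith [hl k]

theorem SS_nonneg (hl : ∀ k, 0 ≤ l k) (k : ℕ) : 0 ≤ SS l k := Finset.sum_nonneg fun k _ => hl k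

theorem SS_tendsto (hs : Summable l) : Tendsto (SS l) atTop (𝓝 (∑' k, l k)) :=
  hs.hasSum.tendsto_sum_nat

theorem SS_le (hl : ∀ k, 0 ≤ l k) (hs : Summable l) (k : ℕ) : SS l k ≤ ∑' k, l k :=
  hs.sum_le_tsum _ fun k _ => hl k

theorem cc_nonneg (k : ℕ) (t : ℝ) : 0 ≤ cc l k t := le_max_left _ _

theorem cc_le (hl : ∀ k, 0 ≤ l k) (k : ℕ) (t : ℝ) : cc l k t ≤ l k :=
  max_le (hl k) (min_le_right _ _)

theorem cc_mono (k : ℕ) : Monotone (cc l k) := fun s t h =>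
  max_le_max le_rfl (min_le_min (by linarith) le_rfl)

theorem cc_sum (hl : ∀ k, 0 ≤ l k) (K : ℕ) (t : ℝ) :
    ∑ k ∈ Finset.range K, cc l k t = max 0 (min t (SS l K)) := by
  induction K with
  | zero => simp [SS]
  | succ K ih =>
    rw [Finset.sum_range_succ, ih, SS_succ, cc]
    have h1 := SS_nonneg hl K
    have h2 := hl K
    rcases le_total t (SS l K) with h | h
    · rw [min_eq_left h, min_eq_left (by linarith : t ≤ SS l K + l K),
        min_eq_left (by linarith : t - SS l K ≤ l K), max_eq_left (by linarith : t - SS l K ≤ 0), add_zero]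
    · rw [min_eq_right h, max_eq_right h1]
      rcases le_total (t - SS l K) (l K) with h3 | h3
      · rw [min_eq_left h3, min_eq_left (by linarith), max_eq_right (by linarith), max_eq_right (by linarith)]
        ring
      · rw [min_eq_right h3, min_eq_right (by linarith), max_eq_right h2, max_eq_right (by linarith)]

theorem inc_norm (hg : ∀ k, LipschitzWith 1 (g k)) (k : ℕ) (s t : ℝ) :
    ‖g k s - g k t‖ ≤ |s - t| := by
  have := (hg k).dist_le_mul s t
  rw [NNReal.coe_one, one_mul, Real.dist_eq, dist_eq_norm] at this
  exact this

theorem PX_summable (hl : ∀ k, 0 ≤ l k) (hs : Summable l) (hg : ∀ k, LipschitzWith 1 (g k)) (t : ℝ) :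
    Summable fun k => g k (cc l k t) - g k 0 := by
  refine Summable.of_norm_bounded hs fun k => ?_
  refine (inc_norm hg k _ _).trans ?_
  rw [sub_zero, abs_of_nonneg (cc_nonneg k t)]
  exact cc_le hl k t

theorem PX_tendsto (hl : ∀ k, 0 ≤ l k) (hs : Summable l) (hg : ∀ k, LipschitzWith 1 (g k)) (t : ℝ) :
    Tendsto (fun K => ∑ k ∈ Finset.range K, (g k (cc l k t) - g k 0)) atTop (𝓝 (PX g l t)) :=
  (PX_summable hl hs hg t).hasSum.tendsto_sum_nat

theorem PX_lip (hl : ∀ k, 0 ≤ l k) (hs : Summable l) (hg : ∀ k, LipschitzWith 1 (g k)) :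
    LipschitzWith 1 (PX g l) := by
  have aux : ∀ a b, a ≤ b → dist (PX g l a) (PX g l b) ≤ b - a := by
    intro a b hab
    refine le_of_tendsto' ((PX_tendsto hl hs hg a).dist (PX_tendsto hl hs hg b)) fun K => ?_
    rw [dist_eq_norm, ← Finset.sum_sub_distrib]
    refine (norm_sum_le _ _).trans ?_
    calc _ ≤ ∑ k ∈ Finset.range K, (cc l k b - cc l k a) := by
          refine Finset.sum_le_sum fun k _ => ?_
          rw [sub_sub_sub_cancel_right]
          refine (inc_norm hg k _ _).trans ?_
          rw [abs_sub_comm, abs_of_nonneg]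
          exact sub_nonneg.2 (cc_mono k hab)
      _ = max 0 (min b (SS l K)) - max 0 (min a (SS l K)) := by
          rw [Finset.sum_sub_distrib, cc_sum hl, cc_sum hl]
      _ ≤ b - a := by
          have h1 := SS_nonneg hl K
          rcases le_total b (SS l K) with h | h <;> rcases le_total a (SS l K) with h' | h' <;>
          rcases le_total 0 a with h2 | h2 <;> rcases le_total 0 b with h3 | h3 <;>
          simp [*] <;> linarith
  refine LipschitzWith.of_dist_le_mul fun a b => ?_
  simp only [NNReal.coe_one, one_mul, Real.dist_eq a b]
  rcases le_total a b with h | h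
  · rw [abs_sub_comm, abs_of_nonneg (by linarith)]; exact aux a b h
  · rw [abs_of_nonneg (by linarith), dist_comm]; exact aux b a h

theorem cc_full (hl : ∀ k, 0 ≤ l k) {k : ℕ} {t : ℝ} (h : SS l (k+1) ≤ t) : cc l k t = l k := by
  rw [SS_succ] at h
  rw [cc, min_eq_right (by linarith), max_eq_right (hl k)]

theorem cc_zero {k : ℕ} {t : ℝ} (h : t ≤ SS l k) : cc l k t = 0 := by
  rw [cc, max_eq_left]
  exact (min_le_left _ _).trans (by linarith)

theorem PX_telescope (hj : ∀ k, g k (l k) = g (k+1) 0) (h0 : g 0 0 = 0) (K : ℕ) :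
    ∑ k ∈ Finset.range K, (g k (l k) - g k 0) = g K 0 := by
  have := Finset.sum_range_sub (fun k => g k 0) K
  rw [h0, sub_zero] at this
  rw [← this]
  exact Finset.sum_congr rfl fun k _ => by rw [hj k]

theorem PX_eq (hl : ∀ k, 0 ≤ l k)
    (hj : ∀ k, g k (l k) = g (k+1) 0) (h0 : g 0 0 = 0) {k : ℕ} {t : ℝ}
    (ht : SS l k ≤ t) (ht' : t ≤ SS l (k+1)) : PX g l t = g k (t - SS l k) := by
  rw [PX, tsum_eq_sum (s := Finset.range (k+1))]
  · rw [Finset.sum_range_succ]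
    have h1 : ∑ j ∈ Finset.range k, (g j (cc l j t) - g j 0) = g k 0 := by
      rw [← PX_telescope hj h0 k]
      refine Finset.sum_congr rfl fun j hj => ?_
      rw [cc_full hl]
      exact (SS_mono hl (Finset.mem_range.1 hj)).trans ht
    rw [h1]
    have h2 : cc l k t = t - SS l k := by
      rw [SS_succ] at ht'
      rw [cc, min_eq_left (by linarith), max_eq_right (by linarith)]
    rw [h2]; simp
  · intro j hj
    rw [Finset.mem_range, not_lt] at hj
    rw [cc_zero (ht'.trans (SS_mono hl hj)), sub_self]

theorem PX_halts (hl : ∀ k, 0 ≤ l k) (hs : Summable l) {t : ℝ} (ht : ∑' k, l k ≤ t) :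
    PX g l t = PX g l (∑' k, l k) := by
  unfold PX
  congr 1
  funext k
  rw [cc_full hl ((SS_le hl hs _).trans ht), cc_full hl (SS_le hl hs _)]

theorem PX_start (hl : ∀ k, 0 ≤ l k) : PX g l 0 = 0 := by
  unfold PX
  rw [tsum_congr (g := fun _ => (0 : Euc d)), tsum_zero]
  intro k
  rw [cc_zero (SS_nonneg hl k), sub_self]

theorem PX_end (hl : ∀ k, 0 ≤ l k) (hs : Summable l) (hg : ∀ k, LipschitzWith 1 (g k))
    (hj : ∀ k, g k (l k) = g (k+1) 0) (h0 : g 0 0 = 0) :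
    Tendsto (fun k => g k 0) atTop (𝓝 (PX g l (∑' k, l k))) := by
  have := PX_tendsto hl hs hg (∑' k, l k)
  refine this.congr fun K => ?_
  rw [← PX_telescope hj h0 K]
  refine Finset.sum_congr rfl fun k _ => ?_
  rw [cc_full hl (SS_le hl hs _)]

theorem PX_cover (hl : ∀ k, 0 ≤ l k) (hs : Summable l) :
    volume (Icc 0 (∑' k, l k) \ ⋃ k, Ioo (SS l k) (SS l (k+1))) = 0 := by
  refine measure_mono_null (t := range (SS l) ∪ {∑' k, l k}) ?_
    (((countable_range _).union (countable_singleton _)).measure_zero _)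
  rintro t ⟨⟨h0, hT⟩, hn⟩
  by_contra hcon
  rw [mem_union, not_or] at hcon
  have hlt : t < ∑' k, l k := lt_of_le_of_ne hT fun h => hcon.2 h
  obtain ⟨k, hk⟩ := ((SS_tendsto hs).eventually (lt_mem_nhds hlt)).exists
  classical
  have hex : ∃ k, t < SS l k := ⟨k, hk⟩
  have h1 := Nat.find_spec hex
  rcases Nat.eq_zero_or_pos (Nat.find hex) with h | h
  · rw [h] at h1; simp [SS] at h1; linarith
  · obtain ⟨m, hm⟩ := Nat.exists_eq_succ_of_ne_zero h.ne'
    have h2 := Nat.find_min hex (m := m) (by omega)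
    rw [not_lt] at h2
    rw [hm] at h1
    refine hn (mem_iUnion.2 ⟨m, lt_of_le_of_ne h2 fun h3 => hcon.1 ⟨m, h3⟩, h1⟩)

theorem PX_unit (hl : ∀ k, 0 ≤ l k) (hs : Summable l)
    (hj : ∀ k, g k (l k) = g (k+1) 0) (h0 : g 0 0 = 0)
    (hu : ∀ k, ∀ᵐ t ∂(volume.restrict (Icc (0 : ℝ) (l k))), ‖deriv (g k) t‖ = 1) :
    ∀ᵐ t ∂(volume.restrict (Icc (0 : ℝ) (∑' k, l k))), ‖deriv (PX g l) t‖ = 1 := by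
  have h1 : ∀ k, ∀ᵐ t ∂(volume : Measure ℝ), t ∈ Ioo (SS l k) (SS l (k+1)) → ‖deriv (PX g l) t‖ = 1 := by
    intro k
    have h2 := hu k
    rw [ae_restrict_iff' measurableSet_Icc] at h2
    have h3 := (measurePreserving_sub_right volume (SS l k)).quasiMeasurePreserving.ae h2
    filter_upwards [h3] with t ht hti
    have h4 : PX g l =ᶠ[𝓝 t] fun s => g k (s - SS l k) := by
      filter_upwards [Ioo_mem_nhds hti.1 hti.2] with s hs using PX_eq hl hj h0 hs.1.le hs.2.le
    rw [h4.deriv_eq, deriv_comp_sub_const]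
    refine ht ⟨by linarith [hti.1], ?_⟩
    have := hti.2
    rw [SS_succ] at this
    linarith
  have h2 := PX_cover hl hs
  rw [ae_restrict_iff' measurableSet_Icc]
  rw [measure_eq_zero_iff_ae_notMem] at h2
  filter_upwards [h2, ae_all_iff.2 h1] with t ht1 ht2 ht3
  by_contra hcon
  apply ht1
  refine ⟨ht3, fun h => ?_⟩
  obtain ⟨k, hk⟩ := mem_iUnion.1 h
  exact hcon (ht2 k hk)

theorem PX_lintegral (hl : ∀ k, 0 ≤ l k) (hs : Summable l)
    (hj : ∀ k, g k (l k) = g (k+1) 0) (h0 : g 0 0 = 0) (w : Euc d → ℝ≥0∞) :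
    ∫⁻ t in Icc 0 (∑' k, l k), w (PX g l t) ≤ ∑' k, ∫⁻ s in Icc 0 (l k), w (g k s) := by
  calc _ ≤ ∫⁻ t in ⋃ k, Ioo (SS l k) (SS l (k+1)), w (PX g l t) := by
        refine lintegral_mono' (Measure.restrict_mono_ae ?_) le_rfl
        rw [ae_le_set]
        exact PX_cover hl hs
    _ ≤ ∑' k, ∫⁻ t in Ioo (SS l k) (SS l (k+1)), w (PX g l t) := lintegral_iUnion_le _ _
    _ ≤ _ := by
        refine ENNReal.tsum_le_tsum fun k => ?_
        have := lintegral_shift (fun t => w (PX g l t)) 0 (l k) (SS l k)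
        rw [add_zero, ← SS_succ] at this
        refine (lintegral_mono_set Ioo_subset_Icc_self).trans ?_
        rw [← this]
        refine le_of_eq (setLIntegral_congr_fun measurableSet_Icc fun s hs => ?_)
        rw [PX_eq hl hj h0 (k := k) (by linarith [hs.1]) (by rw [SS_succ]; linarith [hs.2])]
        simp

end

/-- a clean plan irrigating `μ` gives an upper bound for the cost -/
theorem irrigationCost_le_clean {d : ℕ} {μ : Measure (Euc d)} (P : Clean d)
    (hM : P.M = (μ univ).toReal) (hmap : P.ν.map P.pt = μ) (α : ℝ) : irrigationCost α μ ≤ P.E α := by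
  let χ : IrrigationPlan μ :=
    { toFun := P.X
      T := P.T
      measurable := P.meas
      T_nonneg := P.T0
      lipschitz := fun θ _ => P.lip θ
      unit_speed := fun θ _ => P.unit θ
      stopped := fun θ _ => P.halts θ
      start := fun θ _ => P.start θ
      irrigates := by rw [← hM]; exact hmap }
  have hm : ∀ x, χ.clean.mult x = P.mult x := by
    intro x
    rw [clean_mult]
    unfold Clean.mult Clean.ν IrrigationPlan.mult
    rw [Measure.restrict_apply' measurableSet_Icc, hM]
    congr 1
    ext θ
    exact and_comm
  refine (iInf_le _ χ).trans (le_of_eq ?_)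
  rw [clean_cost]
  unfold Clean.E
  have hν : χ.clean.ν = P.ν := by unfold Clean.ν; rw [hM]; rfl
  rw [hν]
  unfold Clean.ν
  refine setLIntegral_congr_fun measurableSet_Icc fun θ h => ?_
  rw [hM] at h
  unfold Clean.C Clean.w
  simp only [hm]
  rw [clean_X χ h, clean_T χ h]

theorem ennreal_rpow_anti {x y : ℝ≥0∞} {z : ℝ} (h : x ≤ y) (hz : z ≤ 0) : y ^ z ≤ x ^ z := by
  have e : z = -(-z) := by ring
  rw [e, ENNReal.rpow_neg y (-z), ENNReal.rpow_neg x (-z), ENNReal.inv_le_inv]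
  exact ENNReal.rpow_le_rpow h (by linarith)

/-- a countable family of arcs joining points -/
structure Arcs (d : ℕ) where
  e : ℕ → Euc d
  γ : ℕ → ℕ → ℕ → ℝ → Euc d
  ℓ : ℕ → ℕ → ℕ → ℝ
  e0 : e 0 = 0
  arc : ∀ k i j, IsArc (γ k i j) (ℓ k i j)
  h0 : ∀ k i j, γ k i j 0 = e i
  h1 : ∀ k i j, γ k i j (ℓ k i j) = e j
  h00 : ∀ k, ℓ k 0 0 = 0

namespace Arcs
variable {d : ℕ} (A : Arcs d) (n : ℕ → ℝ → ℕ)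

def ρ (k i j : ℕ) : Set (Euc d) := A.γ k i j '' Icc 0 (A.ℓ k i j)

theorem meas_ρ (k i j : ℕ) : MeasurableSet (A.ρ k i j) :=
  (isCompact_Icc.image (A.arc k i j).lip.continuous).isClosed.measurableSet

def mm (ν : Measure ℝ) (k : ℕ) (x : Euc d) : ℝ≥0∞ := ν {θ | x ∈ A.ρ k (n k θ) (n (k+1) θ)}

def c (ν : Measure ℝ) (α : ℝ) (k i j : ℕ) : ℝ≥0∞ :=
  ∫⁻ s in Icc 0 (A.ℓ k i j), (A.mm n ν k (A.γ k i j s)) ^ (α - 1)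

def G (θ : ℝ) (k : ℕ) : ℝ → Euc d := A.γ k (n k θ) (n (k+1) θ)
def l (θ : ℝ) (k : ℕ) : ℝ := A.ℓ k (n k θ) (n (k+1) θ)

theorem l_nonneg (θ : ℝ) (k : ℕ) : 0 ≤ A.l n θ k := (A.arc _ _ _).nonneg
theorem G_lip (θ : ℝ) (k : ℕ) : LipschitzWith 1 (A.G n θ k) := (A.arc _ _ _).lip
theorem G_join (θ : ℝ) (k : ℕ) : A.G n θ k (A.l n θ k) = A.G n θ (k+1) 0 := by
  rw [G, l, A.h1, G, A.h0]

variable {n}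

theorem meas_pair (hn : ∀ k, Measurable (n k)) {β : Type*} [MeasurableSpace β] (k : ℕ) (F : ℕ → ℕ → β) :
    Measurable fun θ => F (n k θ) (n (k+1) θ) :=
  (measurable_of_countable (fun q : ℕ × ℕ => F q.1 q.2)).comp ((hn k).prodMk (hn (k+1)))

theorem meas_l (hn : ∀ k, Measurable (n k)) (k : ℕ) : Measurable fun θ => A.l n θ k :=
  meas_pair hn k (A.ℓ k)

theorem meas_G (hn : ∀ k, Measurable (n k)) (k : ℕ) {s : ℝ × ℝ → ℝ} (hs : Measurable s) :
    Measurable fun q : ℝ × ℝ => A.G n q.1 k (s q) := by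
  have h1 : Measurable fun q : (ℕ × ℕ) × ℝ => A.γ k q.1.1 q.1.2 q.2 :=
    measurable_from_prod_countable_right fun q => (A.arc k q.1 q.2).lip.continuous.measurable
  have h2 : Measurable fun q : ℝ × ℝ => ((n k q.1, n (k+1) q.1), s q) :=
    (((hn k).comp measurable_fst).prodMk ((hn (k+1)).comp measurable_fst)).prodMk hs
  exact h1.comp h2

theorem meas_SS (hn : ∀ k, Measurable (n k)) (k : ℕ) : Measurable fun θ => SS (A.l n θ) k :=
  Finset.measurable_sum _ fun j _ => A.meas_l hn j

theorem meas_cc (hn : ∀ k, Measurable (n k)) (k : ℕ) :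
    Measurable fun q : ℝ × ℝ => cc (A.l n q.1) k q.2 := by
  unfold cc
  exact measurable_const.max ((measurable_snd.sub ((A.meas_SS hn k).comp measurable_fst)).min
    ((A.meas_l hn k).comp measurable_fst))

/-- the competitor -/
def plan (hn : ∀ k, Measurable (n k)) (hn0 : ∀ θ, n 0 θ = 0)
    (hs : ∀ θ, Summable (A.l n θ)) (M : ℝ) : Clean d where
  X := fun θ => PX (A.G n θ) (A.l n θ)
  T := fun θ => ∑' k, A.l n θ k
  M := M
  meas := by
    refine measurable_of_tendsto_metrizable
      (f := fun K (q : ℝ × ℝ) => ∑ k ∈ Finset.range K, (A.G n q.1 k (cc (A.l n q.1) k q.2) - A.G n q.1 k 0))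
      (fun K => ?_) ?_
    · refine Finset.measurable_sum _ fun k _ => ?_
      exact (A.meas_G hn k (A.meas_cc hn k)).sub (A.meas_G hn k measurable_const)
    · rw [tendsto_pi_nhds]
      intro q
      exact PX_tendsto (A.l_nonneg n q.1) (hs q.1) (A.G_lip n q.1) q.2
  T0 := fun θ => tsum_nonneg (A.l_nonneg n θ)
  lip := fun θ => PX_lip (A.l_nonneg n θ) (hs θ) (A.G_lip n θ)
  unit := fun θ => PX_unit (A.l_nonneg n θ) (hs θ) (A.G_join n θ)
    (by rw [G, A.h0, hn0, A.e0]) (fun k => (A.arc _ _ _).speed)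
  halts := fun θ t ht => PX_halts (A.l_nonneg n θ) (hs θ) ht
  start := fun θ => PX_start (A.l_nonneg n θ)

theorem tree_plan_all {μ : Measure (Euc d)} {α : ℝ} (hα : α ∈ Ioo (0:ℝ) 1)
    (hn : ∀ k, Measurable (n k)) (hn0 : ∀ θ, n 0 θ = 0) (hs : ∀ θ, Summable (A.l n θ))
    {M : ℝ} (hM : M = (μ univ).toReal) {x : ℝ → Euc d}
    (hx : (volume.restrict (Icc 0 M)).map x = μ)
    (hlim : ∀ᵐ θ ∂(volume.restrict (Icc 0 M)), Tendsto (fun k => A.e (n k θ)) atTop (𝓝 (x θ))) :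
    irrigationCost α μ ≤ ∑' k, ∫⁻ θ in Icc 0 M, A.c n (volume.restrict (Icc 0 M)) α k (n k θ) (n (k+1) θ) := by
  set P := A.plan hn hn0 hs M with hP
  have hG0 : ∀ θ, A.G n θ 0 0 = 0 := fun θ => by rw [G, A.h0, hn0, A.e0]
  have hmap : P.ν.map P.pt = μ := by
    rw [← hx]
    refine Measure.map_congr ?_
    change ∀ᵐ θ ∂(volume.restrict (Icc 0 M)), _
    filter_upwards [hlim] with θ h
    have := PX_end (A.l_nonneg n θ) (hs θ) (A.G_lip n θ) (A.G_join n θ) (hG0 θ)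
    refine tendsto_nhds_unique this ?_
    refine h.congr fun k => ?_
    rw [G, A.h0]
  refine (irrigationCost_le_clean P hM hmap α).trans ?_
  have hmult : ∀ k x, A.mm n (volume.restrict (Icc 0 M)) k x ≤ P.mult x := by
    intro k x
    refine measure_mono ?_
    rintro θ ⟨s, hs', hsx⟩
    refine ⟨SS (A.l n θ) k + s, add_nonneg (SS_nonneg (A.l_nonneg n θ) k) hs'.1, ?_⟩
    change PX (A.G n θ) (A.l n θ) _ = x
    rw [PX_eq (A.l_nonneg n θ) (A.G_join n θ) (hG0 θ) (k := k) (by linarith [hs'.1])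
      (by rw [SS_succ]; linarith [show s ≤ A.l n θ k from hs'.2])]
    rw [add_sub_cancel_left]; exact hsx
  unfold Clean.E
  rw [← lintegral_tsum (fun k => (meas_pair hn k _).aemeasurable)]
  refine lintegral_mono fun θ => ?_
  refine (PX_lintegral (A.l_nonneg n θ) (hs θ) (A.G_join n θ) (hG0 θ) (P.w α)).trans ?_
  refine ENNReal.tsum_le_tsum fun k => ?_
  refine lintegral_mono fun s => ?_
  exact ennreal_rpow_anti (hmult k _) (by linarith [hα.2])

theorem tree_plan {μ : Measure (Euc d)} {α : ℝ} (hα : α ∈ Ioo (0:ℝ) 1)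
    (hn : ∀ k, Measurable (n k)) (hn0 : ∀ θ, n 0 θ = 0)
    {M : ℝ} (hM : M = (μ univ).toReal)
    (hs : ∀ᵐ θ ∂(volume.restrict (Icc 0 M)), ∑' k, ENNReal.ofReal (A.l n θ k) ≠ ⊤) {x : ℝ → Euc d}
    (hx : (volume.restrict (Icc 0 M)).map x = μ)
    (hlim : ∀ᵐ θ ∂(volume.restrict (Icc 0 M)), Tendsto (fun k => A.e (n k θ)) atTop (𝓝 (x θ))) :
    irrigationCost α μ ≤ ∑' k, ∫⁻ θ in Icc 0 M, A.c n (volume.restrict (Icc 0 M)) α k (n k θ) (n (k+1) θ) := by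
  classical
  let S : Set ℝ := {θ | ∑' k, ENNReal.ofReal (A.l n θ k) ≠ ⊤}
  have hS : MeasurableSet S := by
    have : Measurable fun θ => ∑' k, ENNReal.ofReal (A.l n θ k) :=
      Measurable.tsum fun k => (A.meas_l hn k).ennreal_ofReal
    exact (this (measurableSet_singleton ⊤)).compl
  let n' : ℕ → ℝ → ℕ := fun k θ => if θ ∈ S then n k θ else 0
  have hn' : ∀ k, Measurable (n' k) := fun k => Measurable.ite hS (hn k) measurable_const
  have hae : ∀ᵐ θ ∂(volume.restrict (Icc 0 M)), ∀ k, n' k θ = n k θ := by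
    filter_upwards [hs] with θ h k
    exact if_pos h
  have hs' : ∀ θ, Summable (A.l n' θ) := by
    intro θ
    by_cases h : θ ∈ S
    · have e : A.l n' θ = A.l n θ := by
        funext k; simp only [l, n', if_pos h]
      rw [e]
      have := ENNReal.summable_toReal h
      refine this.congr fun k => ?_
      rw [ENNReal.toReal_ofReal (A.l_nonneg n θ k)]
    · have e : A.l n' θ = fun _ => 0 := by
        funext k; simp only [l, n', if_neg h, A.h00]
      rw [e]; exact summable_zero
  have h := A.tree_plan_all (μ := μ) hα hn' (fun θ => by simp only [n', hn0, ite_self]) hs' hM hx ?_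
  · refine h.trans (le_of_eq ?_)
    congr 1
    funext k
    refine lintegral_congr_ae ?_
    have hmm : ∀ x, A.mm n' (volume.restrict (Icc 0 M)) k x = A.mm n (volume.restrict (Icc 0 M)) k x := by
      intro x
      refine measure_congr ?_
      filter_upwards [hae] with θ h
      change (x ∈ A.ρ k (n' k θ) (n' (k+1) θ)) = (x ∈ A.ρ k (n k θ) (n (k+1) θ))
      rw [h, h]
    filter_upwards [hae] with θ h
    simp only [c, hmm, h]
  · filter_upwards [hae, hlim] with θ h h'
    simpa only [h] using h'

end Arcs

theorem young_ennreal {α : ℝ} (hα : α ∈ Ioo (0:ℝ) 1) {m h : ℝ≥0∞} (hm : m ≠ ⊤) (hh : h ≠ ⊤) :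
    m ^ α ≤ ENNReal.ofReal α * (m * h ^ (α - 1)) + ENNReal.ofReal (1 - α) * h ^ α := by
  by_cases h0 : h = 0
  · by_cases hm0 : m = 0
    · rw [hm0, ENNReal.zero_rpow_of_pos hα.1]; exact zero_le
    · rw [h0, ENNReal.zero_rpow_of_neg (by linarith [hα.2]), ENNReal.mul_top hm0, ENNReal.mul_top]
      · simp
      · simpa using hα.1
  lift m to NNReal using hm
  lift h to NNReal using hh
  have hh0 : h ≠ 0 := by simpa using h0
  have key := Real.geom_mean_le_arith_mean2_weighted (w₁ := α) (w₂ := 1 - α)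
    (p₁ := (m:ℝ) * (h:ℝ) ^ (α - 1)) (p₂ := (h:ℝ) ^ α) hα.1.le (by linarith [hα.2])
    (by positivity) (by positivity) (by ring)
  have hpos : (0:ℝ) < h := by
    have := pos_iff_ne_zero.2 hh0
    exact_mod_cast this
  have e : ((m:ℝ) * (h:ℝ) ^ (α - 1)) ^ α * ((h:ℝ) ^ α) ^ (1 - α) = (m:ℝ) ^ α := by
    rw [Real.mul_rpow (by positivity) (by positivity), ← Real.rpow_mul hpos.le, ← Real.rpow_mul hpos.le,
      mul_assoc, ← Real.rpow_add hpos]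
    have : (α - 1) * α + α * (1 - α) = 0 := by ring
    rw [this, Real.rpow_zero, mul_one]
  rw [e] at key
  rw [← ENNReal.coe_rpow_of_nonneg _ hα.1.le, ← ENNReal.coe_rpow_of_nonneg _ hα.1.le,
    ← ENNReal.coe_rpow_of_ne_zero hh0]
  rw [ENNReal.ofReal, ENNReal.ofReal]
  norm_cast
  rw [← NNReal.coe_le_coe]
  push_cast
  rw [Real.coe_toNNReal _ hα.1.le, Real.coe_toNNReal _ (by linarith [hα.2])]
  exact key

theorem tonelli_hit {d : ℕ} {ν : Measure ℝ} [IsFiniteMeasure ν] {η : Measure (Euc d)} [SFinite η]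
    {K : Set (ℝ × Euc d)} (hK : MeasurableSet K) {w : Euc d → ℝ≥0∞} (hw : Measurable w) :
    ∫⁻ x, w x * ν {θ | (θ, x) ∈ K} ∂η = ∫⁻ θ, ∫⁻ x in {x | (θ, x) ∈ K}, w x ∂η ∂ν := by
  have h1 : ∀ x, w x * ν {θ | (θ, x) ∈ K} = ∫⁻ θ, K.indicator (fun q => w q.2) (θ, x) ∂ν := by
    intro x
    have hm : MeasurableSet {θ | (θ, x) ∈ K} := measurable_prodMk_right hK
    rw [← setLIntegral_const, ← lintegral_indicator hm]
    rfl
  have h2 : ∀ θ, ∫⁻ x in {x | (θ, x) ∈ K}, w x ∂η = ∫⁻ x, K.indicator (fun q => w q.2) (θ, x) ∂η := by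
    intro θ
    have hm : MeasurableSet {x | (θ, x) ∈ K} := measurable_prodMk_left hK
    rw [← lintegral_indicator hm]
    rfl
  simp only [h1, h2]
  rw [lintegral_lintegral_swap]
  have : Measurable (K.indicator fun q : ℝ × Euc d => w q.2) := (hw.comp measurable_snd).indicator hK
  exact (this.comp measurable_swap).aemeasurable

theorem sfinite_union {d : ℕ} {s : ℕ → Set (Euc d)} (hfin : ∀ i, μH[1] (s i) ≠ ⊤)
    (hms : ∀ i, MeasurableSet (s i)) :
    SFinite ((μH[1] : Measure (Euc d)).restrict (⋃ i, s i)) := by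
  rw [← iUnion_disjointed, Measure.restrict_iUnion (disjoint_disjointed s)
    (fun i => MeasurableSet.disjointed hms i)]
  have : ∀ i, IsFiniteMeasure ((μH[1] : Measure (Euc d)).restrict (disjointed s i)) := fun i =>
    ⟨by
      rw [Measure.restrict_apply_univ]
      exact lt_of_le_of_lt (measure_mono (disjointed_subset s i)) (hfin i).lt_top⟩
  infer_instance

namespace Clean
variable {d : ℕ} (P : Clean d)

theorem mult_rpow {α : ℝ} (hα : α ∈ Ioo (0:ℝ) 1) {m : ℝ≥0∞} (hm : m ≠ ⊤) : m ^ (α - 1) * m = m ^ α := by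
  by_cases h0 : m = 0
  · rw [h0, mul_zero, ENNReal.zero_rpow_of_pos hα.1]
  · conv_lhs => rw [← ENNReal.rpow_one m, ← ENNReal.rpow_mul]
    rw [one_mul, ← ENNReal.rpow_add _ _ h0 hm]
    congr 1; ring

theorem E_bound {α : ℝ} (hα : α ∈ Ioo (0:ℝ) 1) {s : ℕ → Set (Euc d)} (hfin : ∀ i, μH[1] (s i) ≠ ⊤)
    (hms : ∀ i, MeasurableSet (s i)) : ∫⁻ x in ⋃ i, s i, P.mult x ^ α ∂μH[1] ≤ P.E α := by
  have := sfinite_union hfin hms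
  calc _ = ∫⁻ x in ⋃ i, s i, P.w α x * P.ν {θ | (θ, x) ∈ {q : ℝ × Euc d | q.1 ∈ P.hit 0 q.2}} ∂μH[1] := by
        refine lintegral_congr fun x => ?_
        exact (mult_rpow hα (ne_top_of_le_ne_top ENNReal.ofReal_ne_top (P.mult_le x))).symm
    _ = _ := tonelli_hit (P.meas_hit 0) (P.meas_w α)
    _ ≤ _ := by
        refine lintegral_mono fun θ => ?_
        have e : {x | (θ, x) ∈ {q : ℝ × Euc d | q.1 ∈ P.hit 0 q.2}} = P.X θ '' Icc 0 (P.T θ) := by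
          have := P.hit_tail 0 θ
          rw [max_eq_right (P.T0 θ)] at this
          exact this
        rw [e]
        refine le_trans ?_ (lintegral_image_le (P.lip θ) 0 (P.T θ) (P.meas_w α))
        exact lintegral_mono' (Measure.restrict_mono_measure Measure.restrict_le_self _) le_rfl

end Clean

namespace Arcs
variable {d : ℕ} (A : Arcs d) {n : ℕ → ℝ → ℕ}

theorem ρ_fin (k i j : ℕ) : μH[1] (A.ρ k i j) ≠ ⊤ := by
  refine ne_top_of_le_ne_top ?_ (hausd_image_le (A.arc k i j).lip _)
  simp

theorem meas_inρ (hn : ∀ k, Measurable (n k)) (k : ℕ) :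
    MeasurableSet {q : ℝ × Euc d | q.2 ∈ A.ρ k (n k q.1) (n (k+1) q.1)} := by
  have h1 : MeasurableSet {q : (ℕ × ℕ) × Euc d | q.2 ∈ A.ρ k q.1.1 q.1.2} := by
    have : {q : (ℕ × ℕ) × Euc d | q.2 ∈ A.ρ k q.1.1 q.1.2} = ⋃ p : ℕ × ℕ, {p} ×ˢ A.ρ k p.1 p.2 := by
      ext ⟨p, x⟩
      simp only [mem_iUnion, mem_prod, mem_singleton_iff]
      constructor
      · intro h; exact ⟨p, rfl, h⟩
      · rintro ⟨p', rfl, h⟩; exact h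
    rw [this]
    exact MeasurableSet.iUnion fun p => (measurableSet_singleton p).prod (A.meas_ρ k _ _)
  have h2 : Measurable fun q : ℝ × Euc d => ((n k q.1, n (k+1) q.1), q.2) :=
    (((hn k).comp measurable_fst).prodMk ((hn (k+1)).comp measurable_fst)).prodMk measurable_snd
  exact h2 h1

theorem level {α : ℝ} (hα : α ∈ Ioo (0:ℝ) 1) (hn : ∀ k, Measurable (n k)) {ν : Measure ℝ}
    [IsFiniteMeasure ν] {mh : Euc d → ℝ≥0∞} (hmh : Measurable mh) (hmt : ∀ x, mh x ≠ ⊤) {Eh : ℝ≥0∞}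
    (hEh : ∀ s : ℕ → Set (Euc d), (∀ i, μH[1] (s i) ≠ ⊤) → (∀ i, MeasurableSet (s i)) →
      ∫⁻ x in ⋃ i, s i, mh x ^ α ∂μH[1] ≤ Eh) (k : ℕ) {Λ : ℝ≥0∞} (hΛt : Λ ≠ ⊤) :
    ∫⁻ θ, A.c n ν α k (n k θ) (n (k+1) θ) ∂ν ≤
      ENNReal.ofReal α * (Λ ^ (α - 1) * ∫⁻ θ, (∫⁻ s in Icc 0 (A.l n θ k), mh (A.G n θ k s) ^ (α - 1)) ∂ν)
        + ENNReal.ofReal (1 - α) * (Λ ^ α * Eh) := by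
  let U : Set (Euc d) := ⋃ i : ℕ, A.ρ k i.unpair.1 i.unpair.2
  have hU : ∀ i j, A.ρ k i j ⊆ U := fun i j => by
    have := subset_iUnion (fun i : ℕ => A.ρ k i.unpair.1 i.unpair.2) (Nat.pair i j)
    simpa using this
  have hsf : SFinite ((μH[1] : Measure (Euc d)).restrict U) := sfinite_union (fun i => A.ρ_fin k _ _)
    (fun i => A.meas_ρ k _ _)
  have hK := A.meas_inρ hn k
  have hmm : Measurable (A.mm n ν k) := measurable_measure_prodMk_right hK
  have hmmt : ∀ x, A.mm n ν k x ≠ ⊤ := fun x => measure_ne_top _ _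
  have hW : Measurable fun x => mh x ^ (α - 1) := hmh.pow_const _
  have hrestr : ∀ i j, ((μH[1] : Measure (Euc d)).restrict U).restrict (A.ρ k i j) =
      (μH[1] : Measure (Euc d)).restrict (A.ρ k i j) := fun i j => by
    rw [Measure.restrict_restrict (A.meas_ρ k i j), inter_eq_left.2 (hU i j)]
  have hton : ∀ w : Euc d → ℝ≥0∞, Measurable w → ∫⁻ x in U, w x * A.mm n ν k x ∂μH[1] =
      ∫⁻ θ, ∫⁻ x in A.ρ k (n k θ) (n (k+1) θ), w x ∂μH[1] ∂ν := by
    intro w hw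
    have := tonelli_hit (ν := ν) (η := (μH[1] : Measure (Euc d)).restrict U) hK hw
    refine this.trans ?_
    refine lintegral_congr fun θ => ?_
    change ∫⁻ x in A.ρ k (n k θ) (n (k+1) θ), w x ∂((μH[1] : Measure (Euc d)).restrict U) = _
    rw [hrestr]
  calc _ ≤ ∫⁻ θ, ∫⁻ x in A.ρ k (n k θ) (n (k+1) θ), A.mm n ν k x ^ (α - 1) ∂μH[1] ∂ν := by
        refine lintegral_mono fun θ => ?_
        exact (A.arc _ _ _).lintegral_le (hmm.pow_const _)
    _ = ∫⁻ x in U, A.mm n ν k x ^ (α - 1) * A.mm n ν k x ∂μH[1] := (hton _ (hmm.pow_const _)).symm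
    _ ≤ ∫⁻ x in U, (ENNReal.ofReal α * (Λ ^ (α - 1) * (mh x ^ (α - 1) * A.mm n ν k x)) +
          ENNReal.ofReal (1 - α) * (Λ ^ α * mh x ^ α)) ∂μH[1] := by
        refine lintegral_mono fun x => ?_
        rw [Clean.mult_rpow hα (hmmt x)]
        refine (young_ennreal hα (hmmt x) (ENNReal.mul_ne_top hΛt (hmt x))).trans (le_of_eq ?_)
        rw [ENNReal.mul_rpow_of_ne_top hΛt (hmt x), ENNReal.mul_rpow_of_ne_top hΛt (hmt x)]
        ring
    _ = ENNReal.ofReal α * (Λ ^ (α - 1) * ∫⁻ x in U, mh x ^ (α - 1) * A.mm n ν k x ∂μH[1]) +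
          ENNReal.ofReal (1 - α) * (Λ ^ α * ∫⁻ x in U, mh x ^ α ∂μH[1]) := by
        have m1 : Measurable fun x => mh x ^ (α - 1) * A.mm n ν k x := hW.mul hmm
        have m2 : Measurable fun x => mh x ^ α := hmh.pow_const _
        rw [lintegral_add_left ((m1.const_mul _).const_mul _), lintegral_const_mul _ (m1.const_mul _),
          lintegral_const_mul _ m1, lintegral_const_mul _ (m2.const_mul _), lintegral_const_mul _ m2]
    _ ≤ _ := by
        gcongr
        · rw [hton _ hW]
          exact lintegral_mono (fun θ => lintegral_image_le (A.arc k (n k θ) (n (k+1) θ)).lip 0 (A.l n θ k) hW)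
        · exact hEh _ (fun i => A.ρ_fin k _ _) (fun i => A.meas_ρ k _ _)

end Arcs

namespace Clean
variable {d : ℕ} (P : Clean d)

theorem tail_small {α : ℝ} {θ : ℝ} (h : P.C α θ ≠ ⊤) (hT : 0 < P.T θ) {ε : ℝ≥0∞} (hε : ε ≠ 0) :
    ∃ s0, 0 ≤ s0 ∧ s0 < P.T θ ∧ ∀ s, s0 ≤ s → ∫⁻ t in Icc s (P.T θ), P.w α (P.X θ t) ≤ ε := by
  obtain ⟨δ, hδ, h1⟩ := exists_pos_setLIntegral_lt_of_measure_lt h hε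
  obtain ⟨r, hr0, hr⟩ := ENNReal.lt_iff_exists_nnreal_btwn.1 hδ
  have hr0' : (0:ℝ) < r := by
    have : 0 < r := by exact_mod_cast hr0
    exact this
  refine ⟨max 0 (P.T θ - r), le_max_left _ _, max_lt hT (by linarith), fun s hs => ?_⟩
  have hs0 : 0 ≤ s := (le_max_left _ _).trans hs
  have hsr : P.T θ - r ≤ s := (le_max_right _ _).trans hs
  have h2 := h1 (Icc s (P.T θ)) (by
    refine lt_of_le_of_lt (Measure.restrict_apply_le _ _) (lt_of_le_of_lt ?_ hr)
    rw [Real.volume_Icc, ENNReal.ofReal_le_iff_le_toReal (by simp)]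
    simp; linarith)
  rw [Measure.restrict_restrict measurableSet_Icc, inter_eq_left.2 (Icc_subset_Icc_left hs0)] at h2
  exact h2.le

theorem select {α : ℝ} (hα : α < 1) (hE : P.E α ≠ ⊤) (ε : ℕ → ℝ≥0∞) (hε : ∀ k, ε k ≠ 0)
    {wh : Euc d → ℝ≥0∞} (hwh : ∀ x, wh x ≤ P.w α x) :
    ∃ (e : ℕ → Euc d) (n : ℕ → ℝ → ℕ), e 0 = 0 ∧ (∀ k, Measurable (n k)) ∧ (∀ θ, n 0 θ = 0) ∧
      ∀ᵐ θ ∂P.ν, ∀ k, Vd wh (e (n (k+1) θ)) (P.pt θ) ≤ ε k := by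
  classical
  have hD := fun p : {p : ℚ // 0 ≤ p} => P.D_lemma hα hE (p := ((p : ℚ) : ℝ)) (by exact_mod_cast p.2)
    MeasurableSet.univ
  choose D hDc _ hDh using hD
  obtain ⟨e', he'⟩ : ∃ f : ℕ → Euc d, (⋃ p, D p) ∪ {0} = range f :=
    ((countable_iUnion hDc).union (countable_singleton 0)).exists_eq_range ⟨0, Or.inr rfl⟩
  let e : ℕ → Euc d := fun i => Nat.casesOn i 0 e'
  have he : ∀ p, ∀ x ∈ D p, ∃ i, e i = x := by
    intro p x hx
    have : x ∈ range e' := by rw [← he']; exact Or.inl (mem_iUnion.2 ⟨p, hx⟩)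
    obtain ⟨i, hi⟩ := this
    exact ⟨i+1, hi⟩
  let tl : ℝ → ℝ → ℝ≥0∞ := fun p θ => ∫⁻ t in Icc p (P.T θ), P.w α (P.X θ t)
  have htl : ∀ p, Measurable (tl p) := fun p => meas_int measurable_const P.measT (P.meas_wX α)
  let good : ℕ → ℕ → Set ℝ := fun k i => ⋃ p : {p : ℚ // 0 ≤ p}, {θ | tl (p : ℚ) θ ≤ ε k} ∩ P.hit (p : ℚ) (e i)
  have hgood : ∀ k i, MeasurableSet (good k i) := fun k i =>
    MeasurableSet.iUnion fun p => (measurableSet_le (htl _) measurable_const).inter (P.meas_hit' _ _)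
  have hgu : ∀ k, MeasurableSet (⋃ i, good k i) := fun k => MeasurableSet.iUnion (hgood k)
  let pr : ℕ → ℝ → ℕ → Prop := fun k θ i => θ ∈ good k i ∨ θ ∉ ⋃ i, good k i
  have hpr : ∀ k θ, ∃ i, pr k θ i := by
    intro k θ
    by_cases h : θ ∈ ⋃ i, good k i
    · obtain ⟨i, hi⟩ := mem_iUnion.1 h
      exact ⟨i, Or.inl hi⟩
    · exact ⟨0, Or.inr h⟩
  let n : ℕ → ℝ → ℕ := fun k θ => Nat.casesOn k 0 fun k => Nat.find (hpr k θ)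
  refine ⟨e, n, rfl, ?_, fun _ => rfl, ?_⟩
  · rintro (_ | k)
    · exact measurable_const
    · exact measurable_find (hpr k) fun i => (hgood k i).union (hgu k).compl
  filter_upwards [P.ae_C_lt_top hE, ae_all_iff.2 hDh] with θ hC hθ k
  have hmem : θ ∈ ⋃ i, good k i := by
    rcases (P.T0 θ).eq_or_lt with h0 | hT
    · refine mem_iUnion.2 ⟨0, mem_iUnion.2 ⟨⟨0, le_rfl⟩, ?_, ?_⟩⟩
      · change ∫⁻ t in Icc (((0:ℚ)):ℝ) (P.T θ), _ ≤ _
        rw [← h0]; simp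
      · exact ⟨0, by simp, P.start θ⟩
    · obtain ⟨s0, hs0, hsT, hs⟩ := P.tail_small hC.ne hT (hε k)
      obtain ⟨q, hq1, hq2⟩ := exists_rat_btwn hsT
      have hq0 : (0:ℚ) ≤ q := by
        have : (0:ℝ) ≤ q := hs0.trans hq1.le
        exact_mod_cast this
      obtain ⟨x, hx, hxh⟩ := hθ ⟨q, hq0⟩ (by
        simp only [preimage_univ, inter_univ, Real.volume_Icc]
        simp; exact hq2)
      obtain ⟨i, hi⟩ := he _ x hx
      refine mem_iUnion.2 ⟨i, mem_iUnion.2 ⟨⟨q, hq0⟩, hs q hq1.le, ?_⟩⟩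
      rw [hi]; exact hxh
  have hg : θ ∈ good k (n (k+1) θ) := by
    rcases Nat.find_spec (hpr k θ) with h | h
    · exact h
    · exact absurd hmem h
  obtain ⟨p, hp1, t, hpt, hpx⟩ := mem_iUnion.1 hg
  rw [← hpx]
  by_cases htT : t ≤ P.T θ
  · calc _ ≤ ∫⁻ s in Icc t (P.T θ), wh (P.X θ s) := Vd_le_of (P.lip θ) htT
      _ ≤ ∫⁻ s in Icc t (P.T θ), P.w α (P.X θ s) := lintegral_mono fun s => hwh _
      _ ≤ tl (p : ℚ) θ := lintegral_mono_set (Icc_subset_Icc_left hpt)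
      _ ≤ _ := hp1
  · rw [P.halts θ t (not_le.1 htT).le]
    refine (Vd_le_of (P.lip θ) le_rfl).trans ?_
    simp

end Clean

/-- choice of arcs -/
theorem exists_arcs {d : ℕ} {wh : Euc d → ℝ≥0∞} (hm : Measurable wh) (e : ℕ → Euc d) (he : e 0 = 0)
    (ε : ℕ → ℝ≥0∞) (hε : ∀ k, ε k ≠ 0) : ∃ A : Arcs d, A.e = e ∧
      ∀ k i j, ∫⁻ s in Icc 0 (A.ℓ k i j), wh (A.γ k i j s) ≤ Vd wh (e i) (e j) + ε k := by
  have h : ∀ k i j, ∃ (γ : ℝ → Euc d) (ℓ : ℝ), IsArc γ ℓ ∧ γ 0 = e i ∧ γ ℓ = e j ∧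
      ∫⁻ s in Icc 0 ℓ, wh (γ s) ≤ Vd wh (e i) (e j) + ε k ∧ (i = 0 → j = 0 → ℓ = 0) := by
    intro k i j
    by_cases hij : i = j
    · refine ⟨fun _ => e i, 0, ⟨le_rfl, LipschitzWith.const' _, ?_, ?_⟩, rfl, by rw [hij], ?_, fun _ _ => rfl⟩
      · rw [Icc_self, Measure.restrict_eq_zero.2 (by simp)]; simp
      · simp
      · simp
    · by_cases ht : Vd wh (e i) (e j) = ⊤
      · obtain ⟨γ, ℓ, h1, h2, h3⟩ := exists_arc_any (e i) (e j)
        exact ⟨γ, ℓ, h1, h2, h3, by rw [ht, top_add]; exact le_top, fun a b => absurd (a.trans b.symm) hij⟩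
      · obtain ⟨γ, ℓ, h1, h2, h3, h4⟩ := Vd_exists_arc hm (ENNReal.lt_add_right ht (hε k))
        exact ⟨γ, ℓ, h1, h2, h3, h4.le, fun a b => absurd (a.trans b.symm) hij⟩
  choose γ ℓ h1 h2 h3 h4 h5 using h
  exact ⟨⟨e, γ, ℓ, he, h1, h2, h3, fun k => h5 k 0 0 rfl rfl⟩, rfl, h4⟩

theorem exists_Λ {α : ℝ} (hα : α ∈ Ioo (0:ℝ) 1) {Eh η : ℝ≥0∞} (hE : Eh ≠ ⊤) (h0 : η ≠ 0) (ht : η ≠ ⊤) :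
    ∃ Λ : ℝ≥0∞, Λ ≠ 0 ∧ Λ ≠ ⊤ ∧ Λ ^ α * Eh ≤ η := by
  have hE1 : Eh + 1 ≠ ⊤ := ENNReal.add_ne_top.2 ⟨hE, ENNReal.one_ne_top⟩
  have hE0 : Eh + 1 ≠ 0 := by simp
  refine ⟨(η / (Eh + 1)) ^ (1 / α), ?_, ?_, ?_⟩
  · have : 0 < (η / (Eh + 1)) ^ (1 / α) := ENNReal.rpow_pos (ENNReal.div_pos h0 hE1) (ENNReal.div_ne_top ht hE0)
    exact this.ne'
  · exact ENNReal.rpow_ne_top_of_nonneg (by have := hα.1; positivity) (ENNReal.div_ne_top ht hE0)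
  · rw [← ENNReal.rpow_mul, one_div, inv_mul_cancel₀ hα.1.ne', ENNReal.rpow_one]
    calc η / (Eh + 1) * Eh ≤ η / (Eh + 1) * (Eh + 1) := by gcongr; exact le_self_add
      _ = η := ENNReal.div_mul_cancel hE0 hE1

theorem exists_small {K η : ℝ≥0∞} (hK : K ≠ ⊤) (h0 : η ≠ 0) :
    ∃ ε : ℝ≥0∞, ε ≠ 0 ∧ ε ≤ η ∧ K * ε ≤ η := by
  have hK1 : K + 1 ≠ ⊤ := ENNReal.add_ne_top.2 ⟨hK, ENNReal.one_ne_top⟩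
  have hK0 : K + 1 ≠ 0 := by simp
  refine ⟨η / (K + 1), (ENNReal.div_pos h0 hK1).ne', ?_, ?_⟩
  · exact ENNReal.div_le_of_le_mul (by rw [mul_add, mul_one]; exact le_add_self)
  · calc K * (η / (K + 1)) ≤ (K + 1) * (η / (K + 1)) := by gcongr; exact le_self_add
      _ = η := ENNReal.mul_div_cancel hK0 hK1

theorem Clean.gen {d : ℕ} (P : Clean d) {μ : Measure (Euc d)} {α : ℝ} (hα : α ∈ Ioo (0:ℝ) 1)
    (hE : P.E α ≠ ⊤) (hM : P.M = (μ univ).toReal) (hmap : P.ν.map P.pt = μ) {mh : Euc d → ℝ≥0∞}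
    (hmh : Measurable mh) (hle : ∀ x, P.mult x ≤ mh x) {B : ℝ≥0∞} (hB : ∀ x, mh x ≤ B) (hBt : B ≠ ⊤)
    {Eh : ℝ≥0∞} (hEht : Eh ≠ ⊤)
    (hEh : ∀ s : ℕ → Set (Euc d), (∀ i, μH[1] (s i) ≠ ⊤) → (∀ i, MeasurableSet (s i)) →
      ∫⁻ x in ⋃ i, s i, mh x ^ α ∂μH[1] ≤ Eh) {v : ℝ → ℝ≥0∞} (hv : Measurable v)
    (hvV : ∀ᵐ θ ∂P.ν, Vd (fun x => mh x ^ (α - 1)) 0 (P.pt θ) ≤ v θ) :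
    irrigationCost α μ ≤ ENNReal.ofReal α * ∫⁻ θ, v θ ∂P.ν + ENNReal.ofReal (1 - α) * Eh := by
  by_cases hvt : ∫⁻ θ, v θ ∂P.ν = ⊤
  · rw [hvt, ENNReal.mul_top (by simpa using hα.1), top_add]; exact le_top
  have hα1 : α - 1 ≤ 0 := by linarith [hα.2]
  set wh : Euc d → ℝ≥0∞ := fun x => mh x ^ (α - 1) with hwhdef
  have hwhm : Measurable wh := hmh.pow_const _
  have hwh : ∀ x, wh x ≤ P.w α x := fun x => ennreal_rpow_anti (hle x) hα1
  have hB1 : B + 1 ≠ ⊤ := ENNReal.add_ne_top.2 ⟨hBt, ENNReal.one_ne_top⟩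
  set b : ℝ≥0∞ := (B + 1) ^ (α - 1) with hb
  have hb0 : b ≠ 0 := (ENNReal.rpow_pos (by simp) hB1).ne'
  have hbt : b ≠ ⊤ := ENNReal.rpow_ne_top_of_ne_zero (by simp) hB1
  have hbw : ∀ x, b ≤ wh x := fun x => ennreal_rpow_anti ((hB x).trans le_self_add) hα1
  set N := P.ν univ with hN
  have hNt : N ≠ ⊤ := measure_ne_top _ _
  refine ENNReal.le_of_forall_pos_le_add fun ε0 hε0 _ => ?_
  obtain ⟨η, hη0, hηs⟩ := ENNReal.exists_pos_sum_of_countable' (ε := (ε0 : ℝ≥0∞)) (by simpa using hε0.ne') ℕ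
  have hηt : ∀ k, η k ≠ ⊤ := fun k => ((ENNReal.le_tsum k).trans_lt (hηs.trans ENNReal.coe_lt_top)).ne
  have hLam : ∀ k, ∃ Λ : ℝ≥0∞, Λ ≠ 0 ∧ Λ ≠ ⊤ ∧ Λ ^ α * Eh ≤ η k := fun k =>
    exists_Λ hα hEht (hη0 k).ne' (hηt k)
  choose Λ hΛ0 hΛt hΛη using hLam
  have heps : ∀ k, ∃ ε : ℝ≥0∞, ε ≠ 0 ∧ ε ≤ η k ∧
      ((if k = 0 then 1 else Λ k) ^ (α - 1) * (3 * N)) * ε ≤ η k := by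
    intro k
    refine exists_small (ENNReal.mul_ne_top ?_ (ENNReal.mul_ne_top (by simp) hNt)) (hη0 k).ne'
    split_ifs
    · simp
    · exact ENNReal.rpow_ne_top_of_ne_zero (hΛ0 k) (hΛt k)
  choose ε' hε'0 hε'η hε'K using heps
  set ε : ℕ → ℝ≥0∞ := fun k => min (ε' k) (ε' (k+1)) with hεdef
  have hε : ∀ k, ε k ≠ 0 := fun k => by
    have : 0 < ε k := lt_min (pos_iff_ne_zero.2 (hε'0 k)) (pos_iff_ne_zero.2 (hε'0 (k+1)))
    exact this.ne'
  obtain ⟨e, n, he, hn, hn0, hsel⟩ := P.select hα.2 hE ε hε hwh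
  obtain ⟨A, rfl, hA⟩ := exists_arcs hwhm e he ε hε
  set g : ℕ → ℝ → ℝ≥0∞ := fun k θ => ∫⁻ s in Icc 0 (A.l n θ k), wh (A.G n θ k s) with hg
  have hg0 : ∀ᵐ θ ∂P.ν, g 0 θ ≤ v θ + 3 * ε' 0 := by
    filter_upwards [hsel, hvV] with θ h1 h2
    calc g 0 θ ≤ Vd wh (A.e (n 0 θ)) (A.e (n 1 θ)) + ε 0 := hA _ _ _
      _ ≤ (Vd wh (A.e (n 0 θ)) (P.pt θ) + Vd wh (P.pt θ) (A.e (n 1 θ))) + ε 0 := by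
          gcongr; exact Vd_triangle _ _ _
      _ ≤ (v θ + ε 0) + ε 0 := by
          gcongr
          · rw [hn0, A.e0]; exact h2
          · exact (Vd_symm_le _ _).trans (h1 0)
      _ ≤ (v θ + ε' 0) + ε' 0 := by gcongr <;> exact min_le_left _ _
      _ ≤ (v θ + ε' 0) + ε' 0 + ε' 0 := le_self_add
      _ = _ := by ring
  have hg1 : ∀ᵐ θ ∂P.ν, ∀ k, g (k+1) θ ≤ 3 * ε' (k+1) := by
    filter_upwards [hsel] with θ h1 k
    calc g (k+1) θ ≤ Vd wh (A.e (n (k+1) θ)) (A.e (n (k+2) θ)) + ε (k+1) := hA _ _ _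
      _ ≤ (Vd wh (A.e (n (k+1) θ)) (P.pt θ) + Vd wh (P.pt θ) (A.e (n (k+2) θ))) + ε (k+1) := by
          gcongr; exact Vd_triangle _ _ _
      _ ≤ (ε k + ε (k+1)) + ε (k+1) := by
          gcongr
          · exact h1 k
          · exact (Vd_symm_le _ _).trans (h1 (k+1))
      _ ≤ (ε' (k+1) + ε' (k+1)) + ε' (k+1) := by
          gcongr
          · exact min_le_right _ _
          · exact min_le_left _ _
          · exact min_le_left _ _
      _ = _ := by ring
  have hlen : ∀ k θ, b * ENNReal.ofReal (A.l n θ k) ≤ g k θ := by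
    intro k θ
    calc b * ENNReal.ofReal (A.l n θ k) = ∫⁻ s in Icc 0 (A.l n θ k), b := by
          rw [setLIntegral_const, Real.volume_Icc, sub_zero]
      _ ≤ _ := lintegral_mono fun s => hbw _
  have hsum : ∀ᵐ θ ∂P.ν, ∑' k, ENNReal.ofReal (A.l n θ k) ≠ ⊤ := by
    filter_upwards [hg0, hg1, ae_lt_top hv hvt] with θ h0 h1 hvθ
    have h2 : ∑' k, g k θ ≠ ⊤ := by
      rw [tsum_eq_zero_add' ENNReal.summable]
      refine ENNReal.add_ne_top.2 ⟨?_, ?_⟩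
      · refine ne_top_of_le_ne_top ?_ h0
        exact ENNReal.add_ne_top.2 ⟨hvθ.ne, ENNReal.mul_ne_top (by simp)
          (ne_top_of_le_ne_top (hηt 0) (hε'η 0))⟩
      · have h3 : ∑' k, g (k+1) θ ≤ 3 * ∑' k, η k := by
          rw [← ENNReal.tsum_mul_left]
          calc _ ≤ ∑' k, 3 * η (k+1) := ENNReal.tsum_le_tsum fun k => (h1 k).trans (by gcongr; exact hε'η _)
            _ ≤ _ := ENNReal.tsum_comp_le_tsum_of_injective (f := fun k => k+1) (add_left_injective 1) fun k => 3 * η k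
        exact ne_top_of_le_ne_top (ENNReal.mul_ne_top (by simp) (hηs.trans ENNReal.coe_lt_top).ne) h3
    have h4 : b * ∑' k, ENNReal.ofReal (A.l n θ k) ≠ ⊤ := by
      rw [← ENNReal.tsum_mul_left]
      exact ne_top_of_le_ne_top h2 (ENNReal.tsum_le_tsum fun k => hlen k θ)
    intro h5
    rw [h5, ENNReal.mul_top hb0] at h4
    exact h4 rfl
  have hlim : ∀ᵐ θ ∂P.ν, Tendsto (fun k => A.e (n k θ)) atTop (𝓝 (P.pt θ)) := by
    filter_upwards [hsel] with θ h1
    rw [← tendsto_add_atTop_iff_nat 1, tendsto_iff_edist_tendsto_0]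
    have h2 : Tendsto (fun k => b⁻¹ * η k) atTop (𝓝 0) := by
      have := ENNReal.tendsto_atTop_zero_of_tsum_ne_top (hηs.trans ENNReal.coe_lt_top).ne
      have h3 := ENNReal.Tendsto.const_mul (a := b⁻¹) this (Or.inr (ENNReal.inv_ne_top.2 hb0))
      rwa [mul_zero] at h3
    refine tendsto_of_tendsto_of_tendsto_of_le_of_le tendsto_const_nhds h2 (fun _ => zero_le) fun k => ?_
    have h3 : b * edist (A.e (n (k+1) θ)) (P.pt θ) ≤ η k :=
      (Vd_ge hbw _ _).trans ((h1 k).trans ((min_le_left _ _).trans (hε'η k)))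
    calc edist (A.e (n (k+1) θ)) (P.pt θ) = b⁻¹ * (b * edist (A.e (n (k+1) θ)) (P.pt θ)) := by
          rw [← mul_assoc, ENNReal.inv_mul_cancel hb0 hbt, one_mul]
      _ ≤ _ := by gcongr
  refine (A.tree_plan hα hn hn0 hM hsum hmap hlim).trans ?_
  have hmt : ∀ x, mh x ≠ ⊤ := fun x => ne_top_of_le_ne_top hBt (hB x)
  have ha1 : ENNReal.ofReal α + ENNReal.ofReal (1 - α) = 1 := by
    rw [← ENNReal.ofReal_add hα.1.le (by linarith)]; simp
  set base := ENNReal.ofReal α * ∫⁻ θ, v θ ∂P.ν + ENNReal.ofReal (1 - α) * Eh with hbase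
  have hlev : ∀ k, ∫⁻ θ, A.c n P.ν α k (n k θ) (n (k+1) θ) ∂P.ν ≤ (if k = 0 then base else 0) + η k := by
    rintro (_ | k)
    · refine (A.level hα hn hmh hmt hEh 0 (Λ := 1) ENNReal.one_ne_top).trans ?_
      have h2 : ∫⁻ θ, (∫⁻ s in Icc 0 (A.l n θ 0), mh (A.G n θ 0 s) ^ (α - 1)) ∂P.ν ≤
          ∫⁻ θ, v θ ∂P.ν + 3 * ε' 0 * N := by
        refine (lintegral_mono_ae hg0).trans (le_of_eq ?_)
        rw [lintegral_add_left hv, lintegral_const]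
      have h3 : 3 * ε' 0 * N ≤ η 0 := by
        have := hε'K 0
        simp only [if_pos, ENNReal.one_rpow, one_mul] at this
        calc _ = 3 * N * ε' 0 := by ring
          _ ≤ _ := this
      simp only [if_pos, ENNReal.one_rpow, one_mul]
      calc _ ≤ ENNReal.ofReal α * (∫⁻ θ, v θ ∂P.ν + η 0) + ENNReal.ofReal (1 - α) * Eh := by
            gcongr; exact h2.trans (by gcongr)
        _ ≤ ENNReal.ofReal α * ∫⁻ θ, v θ ∂P.ν + 1 * η 0 + ENNReal.ofReal (1 - α) * Eh := by
            rw [mul_add]; gcongr; rw [← ha1]; exact le_self_add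
        _ = _ := by rw [one_mul, hbase]; ring
    · refine (A.level hα hn hmh hmt hEh (k+1) (hΛt (k+1))).trans ?_
      have h2 : ∫⁻ θ, (∫⁻ s in Icc 0 (A.l n θ (k+1)), mh (A.G n θ (k+1) s) ^ (α - 1)) ∂P.ν ≤
          3 * ε' (k+1) * N := by
        refine (lintegral_mono_ae (hg1.mono fun θ h => h k)).trans (le_of_eq ?_)
        rw [lintegral_const]
      have h3 : Λ (k+1) ^ (α - 1) * (3 * ε' (k+1) * N) ≤ η (k+1) := by
        have := hε'K (k+1)
        rw [if_neg (Nat.succ_ne_zero k)] at this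
        refine le_trans (le_of_eq ?_) this
        ring
      rw [if_neg (Nat.succ_ne_zero k), zero_add]
      calc _ ≤ ENNReal.ofReal α * η (k+1) + ENNReal.ofReal (1 - α) * η (k+1) := by
            gcongr
            · exact (by gcongr : _ ≤ Λ (k+1) ^ (α - 1) * (3 * ε' (k+1) * N)).trans h3
            · exact hΛη (k+1)
        _ = η (k+1) := by rw [← add_mul, ha1, one_mul]
  calc _ ≤ ∑' k, ((if k = 0 then base else 0) + η k) := ENNReal.tsum_le_tsum hlev
    _ = base + ∑' k, η k := by rw [ENNReal.tsum_add, tsum_ite_eq]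
    _ ≤ base + ε0 := by gcongr

theorem Vd_mono {d : ℕ} {w w' : Euc d → ℝ≥0∞} (h : ∀ x, w x ≤ w' x) (x y : Euc d) : Vd w x y ≤ Vd w' x y := by
  unfold Vd
  gcongr with f L h1 h2 h3 h4
  exact h _

theorem exists_seg {d : ℕ} (y z : Euc d) :
    ∃ f : ℝ → Euc d, LipschitzWith 1 f ∧ f 0 = y ∧ f (dist y z) = z := by
  by_cases hxy : y = z
  · exact ⟨fun _ => y, LipschitzWith.const' _, rfl, hxy⟩
  · have hn : ‖z - y‖ ≠ 0 := by rw [norm_ne_zero_iff, sub_ne_zero]; exact fun h => hxy h.symm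
    refine ⟨fun t => y + (t / ‖z - y‖) • (z - y), ?_, by simp, ?_⟩
    · refine LipschitzWith.of_dist_le_mul fun s t => ?_
      rw [dist_add_left, dist_eq_norm, ← sub_smul, norm_smul, ← sub_div, norm_div, norm_norm,
        div_mul_cancel₀ _ hn, NNReal.coe_one, one_mul, Real.dist_eq, Real.norm_eq_abs]
    · beta_reduce
      rw [dist_comm, dist_eq_norm, div_self hn, one_smul]; abel

namespace Clean
variable {d : ℕ} (P : Clean d)

def Zc (α : ℝ) (x : Euc d) : ℝ≥0∞ :=
  ⨅ (θ : ℝ) (_ : θ ∈ Icc (0 : ℝ) P.M) (τ : ℝ) (_ : 0 ≤ τ) (_ : P.X θ τ = x),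
    ∫⁻ t in Icc (0 : ℝ) τ, P.w α (P.X θ t)

theorem Zc_le {α θ τ : ℝ} (h : θ ∈ Icc (0 : ℝ) P.M) (hτ : 0 ≤ τ) :
    P.Zc α (P.X θ τ) ≤ ∫⁻ t in Icc (0 : ℝ) τ, P.w α (P.X θ t) :=
  iInf_le_of_le θ <| iInf_le_of_le h <| iInf_le_of_le τ <| iInf_le_of_le hτ <| iInf_le_of_le rfl le_rfl

theorem Vd_le_Zc (α : ℝ) (x : Euc d) : Vd (P.w α) 0 x ≤ P.Zc α x := by
  refine le_iInf fun θ => le_iInf fun h => le_iInf fun τ => le_iInf fun hτ => le_iInf fun hx => ?_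
  rw [← hx, ← P.start θ]
  exact Vd_le_of (P.lip θ) hτ

theorem star {μ : Measure (Euc d)} {α : ℝ} (hα : α ∈ Ioo (0:ℝ) 1)
    (hE : P.E α ≠ ⊤) (hM : P.M = (μ univ).toReal) (hmap : P.ν.map P.pt = μ)
    (hopt : P.E α ≤ irrigationCost α μ) (y z : Euc d) {A : Set ℝ} (hA : MeasurableSet A)
    {u k : ℝ → ℝ≥0∞} (hu : Measurable u) (hk : Measurable k)
    (hVu : ∀ᵐ θ ∂P.ν, θ ∈ A → Vd (P.w α) z (P.pt θ) ≤ u θ)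
    (hku : ∀ᵐ θ ∂P.ν, θ ∈ A → k θ + u θ ≤ P.C α θ) :
    ENNReal.ofReal α * ∫⁻ θ in A, k θ ∂P.ν ≤
      ENNReal.ofReal α * (P.ν A * P.Zc α y) + P.ν A ^ α * ENNReal.ofReal (dist y z) := by
  classical
  have hα1 : α - 1 ≤ 0 := by linarith [hα.2]
  have ha1 : ENNReal.ofReal α + ENNReal.ofReal (1 - α) = 1 := by
    rw [← ENNReal.ofReal_add hα.1.le (by linarith [hα.2])]; simp
  set a := P.ν A with ha
  have hat : a ≠ ⊤ := measure_ne_top _ _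
  set L := ENNReal.ofReal (dist y z) with hL
  obtain ⟨f, hf, hf0, hf1⟩ := exists_seg y z
  set S := f '' Icc 0 (dist y z) with hS
  have hSm : MeasurableSet S := (isCompact_Icc.image hf.continuous).isClosed.measurableSet
  have hSL : μH[1] S ≤ L := by
    refine (hausd_image_le hf _).trans ?_
    rw [Real.volume_Icc, sub_zero]
  set mh : Euc d → ℝ≥0∞ := fun x => P.mult x + S.indicator (fun _ => a) x with hmhd
  have hmh : Measurable mh := P.meas_mult.add (measurable_const.indicator hSm)
  have hle : ∀ x, P.mult x ≤ mh x := fun x => le_self_add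
  have hind : ∀ x, S.indicator (fun _ => a) x ≤ a := fun x => indicator_le_self' (fun _ _ => zero_le) x
  have hB : ∀ x, mh x ≤ ENNReal.ofReal P.M + a := fun x => add_le_add (P.mult_le x) (hind x)
  have hLt : L ≠ ⊤ := ENNReal.ofReal_ne_top
  have haat : a ^ α ≠ ⊤ := ENNReal.rpow_ne_top_of_nonneg hα.1.le hat
  have hEh : ∀ s : ℕ → Set (Euc d), (∀ i, μH[1] (s i) ≠ ⊤) → (∀ i, MeasurableSet (s i)) →
      ∫⁻ x in ⋃ i, s i, mh x ^ α ∂μH[1] ≤ P.E α + a ^ α * L := by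
    intro s hs hsm
    calc ∫⁻ x in ⋃ i, s i, mh x ^ α ∂μH[1] ≤
          ∫⁻ x in ⋃ i, s i, (P.mult x ^ α + S.indicator (fun _ => a ^ α) x) ∂μH[1] := by
          refine lintegral_mono fun x => ?_
          refine (ENNReal.rpow_add_le_add_rpow _ _ hα.1.le hα.2.le).trans ?_
          gcongr
          by_cases hx : x ∈ S
          · simp [hx]
          · simp [hx, ENNReal.zero_rpow_of_pos hα.1]
      _ = ∫⁻ x in ⋃ i, s i, P.mult x ^ α ∂μH[1] + ∫⁻ x in ⋃ i, s i, S.indicator (fun _ => a ^ α) x ∂μH[1] :=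
          lintegral_add_left (P.meas_mult.pow_const _) _
      _ ≤ P.E α + a ^ α * L := by
          gcongr
          · exact P.E_bound hα hs hsm
          · rw [lintegral_indicator hSm, setLIntegral_const]
            gcongr
            exact (Measure.restrict_apply_le _ _).trans hSL
  set wh : Euc d → ℝ≥0∞ := fun x => mh x ^ (α - 1) with hwh
  have hwhw : ∀ x, wh x ≤ P.w α x := fun x => ennreal_rpow_anti (hle x) hα1
  have hVyz : Vd wh y z ≤ a ^ (α - 1) * L := by
    have := Vd_le (w := wh) hf (dist_nonneg (x := y) (y := z))
    rw [hf0, hf1] at this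
    refine this.trans ?_
    calc _ ≤ ∫⁻ t in Icc 0 (dist y z), a ^ (α - 1) := by
          refine setLIntegral_mono' measurableSet_Icc fun t ht => ?_
          refine ennreal_rpow_anti ?_ hα1
          have hx : f t ∈ S := ⟨t, ht, rfl⟩
          simp only [hmhd, indicator_of_mem hx]
          exact le_add_self
      _ = _ := by rw [setLIntegral_const, Real.volume_Icc, sub_zero]
  set v : ℝ → ℝ≥0∞ := A.piecewise (fun θ => (P.Zc α y + a ^ (α - 1) * L) + u θ) (P.C α) with hv
  have hvm : Measurable v := Measurable.piecewise hA (measurable_const.add hu) (P.meas_C α)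
  have hvV : ∀ᵐ θ ∂P.ν, Vd wh 0 (P.pt θ) ≤ v θ := by
    filter_upwards [hVu] with θ h
    by_cases hθ : θ ∈ A
    · rw [hv, piecewise_eq_of_mem _ _ _ hθ]
      refine (Vd_triangle 0 z _).trans ?_
      refine add_le_add ((Vd_triangle 0 y z).trans (add_le_add ?_ hVyz)) ?_
      · exact (Vd_mono hwhw _ _).trans (P.Vd_le_Zc α y)
      · exact (Vd_mono hwhw _ _).trans (h hθ)
    · rw [hv, piecewise_eq_of_notMem _ _ _ hθ]
      refine (Vd_mono hwhw _ _).trans ?_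
      rw [← P.start θ]
      exact Vd_le_of (P.lip θ) (P.T0 θ)
  have hgen := hopt.trans (P.gen hα hE hM hmap hmh hle hB (ENNReal.add_ne_top.2 ⟨ENNReal.ofReal_ne_top, hat⟩)
    (ENNReal.add_ne_top.2 ⟨hE, ENNReal.mul_ne_top haat hLt⟩) hEh hvm hvV)
  have hsplitE : P.E α = ∫⁻ θ in A, P.C α θ ∂P.ν + ∫⁻ θ in Aᶜ, P.C α θ ∂P.ν := (lintegral_add_compl _ hA).symm
  have hsplitv : ∫⁻ θ, v θ ∂P.ν = (a * P.Zc α y + a ^ α * L + ∫⁻ θ in A, u θ ∂P.ν) + ∫⁻ θ in Aᶜ, P.C α θ ∂P.ν := by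
    rw [← lintegral_add_compl v hA]
    congr 1
    · rw [setLIntegral_congr_fun hA (g := fun θ => (P.Zc α y + a ^ (α - 1) * L) + u θ)
        (fun θ h => piecewise_eq_of_mem _ _ _ h), lintegral_add_left measurable_const, setLIntegral_const,
        ← mult_rpow hα hat]
      ring
    · exact setLIntegral_congr_fun hA.compl (fun θ h => piecewise_eq_of_notMem _ _ _ h)
  set I1 := ∫⁻ θ in A, P.C α θ ∂P.ν
  set I2 := ∫⁻ θ in Aᶜ, P.C α θ ∂P.ν
  set U := ∫⁻ θ in A, u θ ∂P.ν
  set K := ∫⁻ θ in A, k θ ∂P.ν with hK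
  have hI : I1 ≠ ⊤ ∧ I2 ≠ ⊤ := by rw [hsplitE] at hE; exact ENNReal.add_ne_top.1 hE
  have hKU : K + U ≤ I1 := by
    rw [hK, ← lintegral_add_left hk]
    refine lintegral_mono_ae ?_
    rw [ae_restrict_iff' hA]
    exact hku
  have hUt : U ≠ ⊤ := ne_top_of_le_ne_top hI.1 (le_add_self.trans hKU)
  set p := ENNReal.ofReal α
  set q := ENNReal.ofReal (1 - α)
  have hpt : p ≠ ⊤ := ENNReal.ofReal_ne_top
  have hqt : q ≠ ⊤ := ENNReal.ofReal_ne_top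
  rw [hsplitv] at hgen
  have h1 : p * K + (p * U + (p * I2 + q * P.E α)) ≤
      (p * (a * P.Zc α y) + a ^ α * L) + (p * U + (p * I2 + q * P.E α)) := by
    calc p * K + (p * U + (p * I2 + q * P.E α)) = p * (K + U) + p * I2 + q * P.E α := by ring
      _ ≤ p * I1 + p * I2 + q * P.E α := by gcongr
      _ = (p + q) * P.E α := by rw [add_mul]; nth_rewrite 2 [hsplitE]; ring
      _ = P.E α := by rw [ha1, one_mul]
      _ ≤ _ := hgen
      _ = (p * (a * P.Zc α y) + (p + q) * (a ^ α * L)) + (p * U + (p * I2 + q * P.E α)) := by ring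
      _ = _ := by rw [ha1, one_mul]
  refine (ENNReal.add_le_add_iff_right ?_).1 h1
  exact ENNReal.add_ne_top.2 ⟨ENNReal.mul_ne_top hpt hUt, ENNReal.add_ne_top.2
    ⟨ENNReal.mul_ne_top hpt hI.2, ENNReal.mul_ne_top hqt hE⟩⟩

end Clean

namespace Clean
variable {d : ℕ} (P : Clean d)

def K (α p θ : ℝ) : ℝ≥0∞ := ∫⁻ t in Icc 0 (min p (P.T θ)), P.w α (P.X θ t)
def R (α p θ : ℝ) : ℝ≥0∞ := ∫⁻ t in Icc p (P.T θ), P.w α (P.X θ t)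

theorem meas_K (α p : ℝ) : Measurable (P.K α p) :=
  meas_int measurable_const (measurable_const.min P.measT) (P.meas_wX α)
theorem meas_R (α p : ℝ) : Measurable (P.R α p) :=
  meas_int measurable_const P.measT (P.meas_wX α)

theorem int_split {F : ℝ → ℝ≥0∞} {a b c : ℝ} (hab : a ≤ b) (hbc : b ≤ c) :
    (∫⁻ t in Icc a b, F t) + (∫⁻ t in Icc b c, F t) = ∫⁻ t in Icc a c, F t := by
  rw [← Icc_union_Ioc_eq_Icc hab hbc, lintegral_union measurableSet_Ioc, ← restrict_Ioc_eq_restrict_Icc (a := b)]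
  rw [Set.disjoint_left]
  intro x hx hx'
  exact absurd hx.2 (not_le.2 hx'.1)

theorem K_add_R (α : ℝ) {p : ℝ} (hp : 0 ≤ p) (θ : ℝ) : P.K α p θ + P.R α p θ = P.C α θ := by
  by_cases h : p ≤ P.T θ
  · rw [K, R, min_eq_left h, int_split hp h, C]
  · rw [K, R, min_eq_right (not_le.1 h).le, Icc_eq_empty h]; simp [C]

theorem Vd_hit (α : ℝ) {p t : ℝ} {z : Euc d} {θ : ℝ} (hp : p ≤ t) (h : P.X θ t = z) :
    Vd (P.w α) z (P.pt θ) ≤ P.R α p θ := by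
  rw [← h]
  by_cases htT : t ≤ P.T θ
  · exact (Vd_le_of (P.lip θ) htT).trans (lintegral_mono_set (Icc_subset_Icc_left hp))
  · rw [P.halts θ t (not_le.1 htT).le]
    refine (Vd_le_of (P.lip θ) le_rfl).trans ?_
    simp

theorem step1 {μ : Measure (Euc d)} {α : ℝ} (hα : α ∈ Ioo (0:ℝ) 1)
    (hE : P.E α ≠ ⊤) (hM : P.M = (μ univ).toReal) (hmap : P.ν.map P.pt = μ)
    (hopt : P.E α ≤ irrigationCost α μ) (z : Euc d) {p : ℝ} (hp : 0 ≤ p) :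
    ∀ᵐ θ ∂P.ν, θ ∈ P.hit p z → P.K α p θ ≤ P.Zc α z := by
  by_cases hZ : P.Zc α z = ⊤
  · rw [hZ]; exact Eventually.of_forall fun _ _ => le_top
  set A := P.hit p z ∩ {θ | P.Zc α z < P.K α p θ} with hA
  have hAm : MeasurableSet A := (P.meas_hit' p z).inter (measurableSet_lt measurable_const (P.meas_K α p))
  have h := P.star hα hE hM hmap hopt z z hAm (P.meas_R α p) (P.meas_K α p)
    (Eventually.of_forall fun θ hθ => by obtain ⟨t, ht, hx⟩ := hθ.1; exact P.Vd_hit α ht hx)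
    (Eventually.of_forall fun θ _ => (P.K_add_R α hp θ).le)
  rw [dist_self, ENNReal.ofReal_zero, mul_zero, add_zero,
    ENNReal.mul_le_mul_iff_right (by simpa using hα.1) ENNReal.ofReal_ne_top] at h
  have h0 : P.ν A = 0 := by
    by_contra h0
    have h1 : ∫⁻ θ in A, P.Zc α z ∂P.ν < ∫⁻ θ in A, P.K α p θ ∂P.ν := by
      refine setLIntegral_strict_mono hAm h0 (P.meas_K α p) ?_ ?_
      · rw [setLIntegral_const]; exact ENNReal.mul_ne_top hZ (measure_ne_top _ _)
      · exact Eventually.of_forall fun θ hθ => hθ.2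
    rw [setLIntegral_const, mul_comm] at h1
    exact absurd h (not_le.2 h1)
  have := measure_eq_zero_iff_ae_notMem.1 h0
  filter_upwards [this] with θ h1 h2
  by_contra h3
  exact h1 ⟨h2, not_le.1 h3⟩

theorem R_small {α θ t : ℝ} (h : P.C α θ ≠ ⊤) (ht0 : 0 < t) (htT : t ≤ P.T θ) {ε : ℝ≥0∞} (hε : ε ≠ 0) :
    ∃ q : ℚ, 0 ≤ q ∧ (q : ℝ) ≤ t ∧ ∫⁻ s in Icc (q : ℝ) t, P.w α (P.X θ s) ≤ ε := by
  obtain ⟨δ, hδ, h1⟩ := exists_pos_setLIntegral_lt_of_measure_lt h hε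
  obtain ⟨r, hr0, hr⟩ := ENNReal.lt_iff_exists_nnreal_btwn.1 hδ
  have hr0' : (0:ℝ) < r := by
    have : 0 < r := by exact_mod_cast hr0
    exact this
  obtain ⟨q, hq1, hq2⟩ := exists_rat_btwn (max_lt ht0 (by linarith : t - r < t))
  have hq0 : (0:ℝ) ≤ q := (le_max_left _ _).trans hq1.le
  refine ⟨q, by exact_mod_cast hq0, hq2.le, ?_⟩
  have hqr : t - r ≤ q := (le_max_right _ _).trans hq1.le
  have h2 := h1 (Icc q t) (by
    refine lt_of_le_of_lt (Measure.restrict_apply_le _ _) (lt_of_le_of_lt ?_ hr)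
    rw [Real.volume_Icc, ENNReal.ofReal_le_iff_le_toReal (by simp)]
    simp; linarith)
  rw [Measure.restrict_restrict measurableSet_Icc, inter_eq_left.2 (Icc_subset_Icc hq0 htT)] at h2
  exact h2.le

theorem step2 {μ : Measure (Euc d)} {α : ℝ} (hα : α ∈ Ioo (0:ℝ) 1)
    (hE : P.E α ≠ ⊤) (hM : P.M = (μ univ).toReal) (hmap : P.ν.map P.pt = μ)
    (hopt : P.E α ≤ irrigationCost α μ) (y z : Euc d) (hz : 0 < P.mult z) :
    ENNReal.ofReal α * P.Zc α z ≤ ENNReal.ofReal α * P.Zc α y + P.w α z * ENNReal.ofReal (dist y z) := by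
  classical
  let u : ℝ → ℝ≥0∞ := fun θ => ⨅ p : {p : ℚ // 0 ≤ p}, (P.hit (p:ℚ) z).piecewise (P.R α (p:ℚ)) (fun _ => ⊤) θ
  have hu : Measurable u := Measurable.iInf fun p => Measurable.piecewise (P.meas_hit' _ _) (P.meas_R α _) measurable_const
  have h := P.star hα hE hM hmap hopt y z (P.meas_hit' 0 z) hu (k := fun _ => P.Zc α z) measurable_const
    (Eventually.of_forall fun θ _ => ?_) ?_
  · change ENNReal.ofReal α * ∫⁻ θ in P.hit 0 z, P.Zc α z ∂P.ν ≤ ENNReal.ofReal α * (P.mult z * _) + P.mult z ^ α * _ at h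
    have hmt : P.mult z ≠ ⊤ := measure_ne_top _ _
    rw [setLIntegral_const, ← mult_rpow hα hmt] at h
    change ENNReal.ofReal α * (P.Zc α z * P.mult z) ≤ _ at h
    have h2 : P.mult z * (ENNReal.ofReal α * P.Zc α z) ≤
        P.mult z * (ENNReal.ofReal α * P.Zc α y + P.w α z * ENNReal.ofReal (dist y z)) := by
      calc _ = ENNReal.ofReal α * (P.Zc α z * P.mult z) := by ring
        _ ≤ _ := h
        _ = _ := by rw [w]; ring
    exact (ENNReal.mul_le_mul_iff_right hz.ne' hmt).1 h2
  · refine le_iInf fun p => ?_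
    by_cases hp : θ ∈ P.hit (p:ℚ) z
    · rw [piecewise_eq_of_mem _ _ _ hp]
      obtain ⟨t, ht, hx⟩ := hp
      exact P.Vd_hit α ht hx
    · rw [piecewise_eq_of_notMem _ _ _ hp]; exact le_top
  · have hIcc : ∀ᵐ θ ∂P.ν, θ ∈ Icc 0 P.M := ae_restrict_mem measurableSet_Icc
    filter_upwards [P.ae_C_lt_top hE, hIcc] with θ hC hθ hh
    have hh' : z ∈ P.X θ '' Icc 0 (P.T θ) := by
      have := P.hit_tail 0 θ
      rw [max_eq_right (P.T0 θ)] at this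
      rw [← this]; exact hh
    obtain ⟨t, ⟨ht0, htT⟩, hx⟩ := hh'
    have hZ : P.Zc α z ≤ ∫⁻ s in Icc 0 t, P.w α (P.X θ s) := by rw [← hx]; exact P.Zc_le hθ ht0
    have hsp := int_split (F := fun s => P.w α (P.X θ s)) ht0 htT
    have hub : ∀ q : ℚ, 0 ≤ q → (q:ℝ) ≤ t → u θ ≤ P.R α q θ := by
      intro q hq hqt
      refine (iInf_le _ (⟨q, hq⟩ : {p : ℚ // 0 ≤ p})).trans ?_
      exact (piecewise_eq_of_mem _ _ _ (show θ ∈ P.hit q z from ⟨t, hqt, hx⟩)).le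
    have hu2 : u θ ≤ ∫⁻ s in Icc t (P.T θ), P.w α (P.X θ s) := by
      rcases ht0.eq_or_lt with h0 | h0
      · have := hub 0 le_rfl (by simpa using ht0)
        rw [← h0]
        simpa [R] using this
      · refine ENNReal.le_of_forall_pos_le_add fun ε hε _ => ?_
        obtain ⟨q, hq0, hqt, hq⟩ := P.R_small hC.ne h0 htT (ε := ε) (by simpa using hε.ne')
        refine (hub q hq0 hqt).trans ?_
        rw [R, ← int_split hqt htT, add_comm]
        gcongr
    calc P.Zc α z + u θ ≤ _ := add_le_add hZ hu2
      _ = _ := hsp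

end Clean

theorem lsc_liminf {d : ℕ} (g : Euc d → ℝ≥0∞) (Γ : Set (Euc d)) :
    LowerSemicontinuous fun x => Filter.liminf g (𝓝[Γ] x) := by
  intro x c hc
  obtain ⟨c', hc1, hc2⟩ := exists_between hc
  have h := eventually_lt_of_lt_liminf hc2
  rw [eventually_nhdsWithin_iff] at h
  filter_upwards [eventually_eventually_nhds.2 h] with x' hx'
  rw [← eventually_nhdsWithin_iff] at hx'
  refine lt_of_lt_of_le hc1 ?_
  exact le_liminf_of_le (by isBoundedDefault) (hx'.mono fun _ h => h.le)

namespace Clean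
variable {d : ℕ} (P : Clean d)

theorem step3 {μ : Measure (Euc d)} {α : ℝ} (hα : α ∈ Ioo (0:ℝ) 1)
    (hE : P.E α ≠ ⊤) (hM : P.M = (μ univ).toReal) (hmap : P.ν.map P.pt = μ)
    (hopt : P.E α ≤ irrigationCost α μ) :
    ∀ᵐ θ ∂P.ν, P.C α θ ≤ Filter.liminf (P.Zc α) (𝓝[{y | 0 < P.mult y}] (P.pt θ)) := by
  have hD := fun (p : {p : ℚ // 0 ≤ p}) (l : ℚ) => P.D_lemma hα.2 hE (p := ((p : ℚ) : ℝ))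
    (by exact_mod_cast p.2) (V := {x | P.w α x ≤ ENNReal.ofReal l})
    (measurableSet_le (P.meas_w α) measurable_const)
  choose D hDc hDV hDh using hD
  have h1 : ∀ᵐ θ ∂P.ν, ∀ p l, ∀ z ∈ D p l, θ ∈ P.hit (p : ℚ) z → P.K α (p : ℚ) θ ≤ P.Zc α z := by
    rw [ae_all_iff]; intro p
    rw [ae_all_iff]; intro l
    rw [ae_ball_iff (hDc p l)]
    intro z _
    exact P.step1 hα hE hM hmap hopt z (by exact_mod_cast p.2)
  have h2 := ae_all_iff.2 fun p => ae_all_iff.2 fun l => hDh p l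
  filter_upwards [h1, h2, P.ae_C_lt_top hE] with θ h1 h2 hC
  rcases (P.T0 θ).eq_or_lt with h0 | hT
  · have : P.C α θ = 0 := by rw [C, ← h0]; simp
    rw [this]; exact zero_le
  refine ENNReal.le_of_forall_pos_le_add fun ε hε _ => ?_
  rw [← tsub_le_iff_right]
  refine le_liminf_of_le (by isBoundedDefault) ?_
  have hεp : (0:ℝ) < ε := hε
  set δ : ℝ := α * ε / 5 with hδ
  have hδ0 : 0 < δ := by have := hα.1; positivity
  obtain ⟨s0, hs0, hsT, hs⟩ := P.tail_small hC.ne hT (ε := ENNReal.ofReal δ) (by simpa using hδ0)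
  obtain ⟨p, hp1, hp2⟩ := exists_rat_btwn hsT
  have hp0 : (0:ℝ) ≤ p := hs0.trans hp1.le
  have hp0' : (0:ℚ) ≤ p := by exact_mod_cast hp0
  set r : ℝ := P.T θ - p with hr
  have hr0 : 0 < r := by linarith
  obtain ⟨l, hl1, hl2⟩ := exists_rat_btwn (show δ / r < 2 * δ / r from by gcongr; linarith)
  have hl1' : δ < l * r := (div_lt_iff₀ hr0).1 hl1
  have hl2' : l * r < 2 * δ := (lt_div_iff₀ hr0).1 hl2
  have hl0 : (0:ℝ) < l := (div_pos hδ0 hr0).trans hl1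
  have hR : P.R α p θ ≤ ENNReal.ofReal δ := hs p hp1.le
  obtain ⟨z, hz, t, hpt, hx⟩ := h2 ⟨p, hp0'⟩ l (by
    intro hzero
    have hae : ∀ᵐ t ∂(volume.restrict (Icc (p:ℝ) (P.T θ))), ENNReal.ofReal l ≤ P.w α (P.X θ t) := by
      rw [ae_restrict_iff' measurableSet_Icc]
      have := measure_eq_zero_iff_ae_notMem.1 hzero
      filter_upwards [this] with t ht1 ht2
      by_contra h3
      exact ht1 ⟨ht2, (not_le.1 h3).le⟩
    have h4 : ENNReal.ofReal l * ENNReal.ofReal r ≤ P.R α p θ := by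
      calc _ = ∫⁻ t in Icc (p:ℝ) (P.T θ), ENNReal.ofReal l := by rw [setLIntegral_const, Real.volume_Icc]
        _ ≤ _ := lintegral_mono_ae hae
    rw [← ENNReal.ofReal_mul hl0.le] at h4
    have h5 := h4.trans hR
    rw [ENNReal.ofReal_le_ofReal_iff hδ0.le] at h5
    linarith)
  have hzw : P.w α z ≤ ENNReal.ofReal l := hDV _ _ hz
  have hzm : 0 < P.mult z := P.mult_pos_of_w hα.2 (ne_top_of_le_ne_top ENNReal.ofReal_ne_top hzw)
  have hKZ : P.K α p θ ≤ P.Zc α z := h1 ⟨p, hp0'⟩ l z hz ⟨t, hpt, hx⟩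
  have hzd : dist (P.pt θ) z ≤ r := by
    rw [← hx]
    change (p:ℝ) ≤ t at hpt
    by_cases htT : t ≤ P.T θ
    · have := (P.lip θ).dist_le_mul (P.T θ) t
      rw [NNReal.coe_one, one_mul, Real.dist_eq, abs_of_nonneg (by linarith)] at this
      exact this.trans (by linarith)
    · rw [P.halts θ t (not_le.1 htT).le, pt, dist_self]; exact hr0.le
  have hball : Metric.ball (P.pt θ) r ∈ 𝓝[{y | 0 < P.mult y}] (P.pt θ) :=
    mem_nhdsWithin_of_mem_nhds (Metric.ball_mem_nhds _ hr0)
  filter_upwards [hball] with y hy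
  rw [tsub_le_iff_right]
  have hyz : dist y z ≤ 2 * r := by
    have := dist_triangle y (P.pt θ) z
    have hy' : dist y (P.pt θ) < r := hy
    linarith
  have h6 := P.step2 hα hE hM hmap hopt y z hzm
  have h7 : P.w α z * ENNReal.ofReal (dist y z) ≤ ENNReal.ofReal (4 * δ) := by
    calc _ ≤ ENNReal.ofReal l * ENNReal.ofReal (2 * r) := by gcongr
      _ = ENNReal.ofReal (l * (2 * r)) := (ENNReal.ofReal_mul hl0.le).symm
      _ ≤ _ := ENNReal.ofReal_le_ofReal (by linarith)
  have h8 : ENNReal.ofReal α * P.C α θ ≤ ENNReal.ofReal α * (P.Zc α y + ε) := by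
    calc ENNReal.ofReal α * P.C α θ = ENNReal.ofReal α * (P.K α p θ + P.R α p θ) := by rw [P.K_add_R α hp0]
      _ ≤ ENNReal.ofReal α * (P.Zc α z + ENNReal.ofReal δ) := by gcongr
      _ = ENNReal.ofReal α * P.Zc α z + ENNReal.ofReal (α * δ) := by rw [mul_add, ENNReal.ofReal_mul hα.1.le]
      _ ≤ (ENNReal.ofReal α * P.Zc α y + ENNReal.ofReal (4 * δ)) + ENNReal.ofReal δ := by
          gcongr
          · exact h6.trans (by gcongr)
          · nlinarith [hα.2]
      _ = ENNReal.ofReal α * P.Zc α y + ENNReal.ofReal (α * ε) := by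
          rw [add_assoc, ← ENNReal.ofReal_add (by positivity) hδ0.le]
          congr 2
          rw [hδ]; ring
      _ = _ := by rw [mul_add, ENNReal.ofReal_mul hα.1.le, ENNReal.ofReal_coe_nnreal]
  exact (ENNReal.mul_le_mul_iff_right (by simpa using hα.1) ENNReal.ofReal_ne_top).1 h8

theorem upper {α : ℝ} (hα : α ∈ Ioo (0:ℝ) 1) (hE : P.E α ≠ ⊤) :
    ∀ᵐ θ ∂P.ν, Filter.liminf (P.Zc α) (𝓝[{y | 0 < P.mult y}] (P.pt θ)) ≤ P.C α θ := by
  by_cases hν : P.ν univ = 0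
  · rw [Measure.measure_univ_eq_zero.1 hν]; simp
  have hIcc : ∀ᵐ θ ∂P.ν, θ ∈ Icc 0 P.M := ae_restrict_mem measurableSet_Icc
  filter_upwards [P.ae_C_lt_top hE, hIcc] with θ hC hθ
  refine liminf_le_of_frequently_le ?_ (by isBoundedDefault)
  rw [Metric.nhdsWithin_basis_ball.frequently_iff]
  intro ε hε
  rcases (P.T0 θ).eq_or_lt with h0 | hT
  · refine ⟨P.pt θ, ⟨Metric.mem_ball_self hε, ?_⟩, P.Zc_le hθ (P.T0 θ)⟩
    have h1 : P.pt θ = 0 := by rw [pt, ← h0, P.start]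
    have h2 : P.hit 0 0 = univ := by
      ext θ'; simp only [mem_univ, iff_true]; exact ⟨0, le_rfl, P.start θ'⟩
    change 0 < P.mult _
    rw [h1, mult, h2]; exact pos_iff_ne_zero.2 hν
  · have hae := P.ae_mult_pos hα.2 hC.ne
    set s := max 0 (P.T θ - ε / 2) with hs
    have hsT : s < P.T θ := max_lt hT (by linarith)
    have hs0 : 0 ≤ s := le_max_left _ _
    have hae2 : ∀ᵐ t ∂(volume.restrict (Icc s (P.T θ))), 0 < P.mult (P.X θ t) :=
      ae_restrict_of_ae_restrict_of_subset (Icc_subset_Icc_left hs0) hae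
    have hne : (volume.restrict (Icc s (P.T θ))) ≠ 0 := by
      rw [Ne, Measure.restrict_eq_zero, Real.volume_Icc]; simpa using hsT
    have : (ae (volume.restrict (Icc s (P.T θ)))).NeBot := ae_neBot.2 hne
    obtain ⟨t, ht1, ht2⟩ := (hae2.and (ae_restrict_mem measurableSet_Icc)).exists
    have ht0 : 0 ≤ t := hs0.trans ht2.1
    refine ⟨P.X θ t, ⟨?_, ht1⟩, (P.Zc_le hθ ht0).trans (lintegral_mono_set (Icc_subset_Icc_right ht2.2))⟩
    have := (P.lip θ).dist_le_mul t (P.T θ)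
    rw [NNReal.coe_one, one_mul, Real.dist_eq, abs_of_nonpos (by linarith [ht2.2])] at this
    have h3 : P.T θ - ε / 2 ≤ t := (le_max_right _ _).trans ht2.1
    change dist _ (P.X θ (P.T θ)) < ε
    linarith

end Clean

theorem clean_Zc {d : ℕ} {μ : Measure (Euc d)} (χ : IrrigationPlan μ) (α : ℝ) : χ.clean.Zc α = χ.Zchi α := by
  funext x
  unfold Clean.Zc IrrigationPlan.Zchi
  refine iInf_congr fun θ => iInf_congr fun h => ?_
  have e : χ.clean.X θ = χ.toFun θ := clean_X χ h
  refine iInf_congr fun τ => iInf_congr fun hτ => ?_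
  rw [e]
  refine iInf_congr fun hx => ?_
  refine lintegral_congr fun t => ?_
  rw [Clean.w, clean_mult]

theorem main_aux {d : ℕ} (α : ℝ) (hα : α ∈ Ioo (0 : ℝ) 1)
    (μ : Measure (Euc d)) (hirr : irrigationCost α μ ≠ ⊤)
    (χ : IrrigationPlan μ) (hopt : χ.IsOptimal α) :
    irrigationCost α μ = ∫⁻ x, χ.landscape α x ∂μ := by
  have hEI : χ.clean.E α = irrigationCost α μ := by rw [← clean_cost]; exact hopt
  have hE : χ.clean.E α ≠ ⊤ := by rw [hEI]; exact hirr
  have hZ : χ.landscape α = fun x => Filter.liminf (χ.clean.Zc α) (𝓝[{y | 0 < χ.clean.mult y}] x) := by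
    funext x
    unfold IrrigationPlan.landscape
    rw [clean_Zc]
    simp only [clean_mult]
  have hmeas : Measurable (χ.landscape α) := by rw [hZ]; exact (lsc_liminf _ _).measurable
  have h1 : ∫⁻ x, χ.landscape α x ∂μ = ∫⁻ θ, χ.landscape α (χ.clean.pt θ) ∂χ.clean.ν := by
    rw [← lintegral_map hmeas χ.clean.meas_pt, clean_map χ]
  rw [h1, ← hEI]
  refine lintegral_congr_ae ?_
  filter_upwards [χ.clean.step3 hα hE rfl (clean_map χ) hEI.le, χ.clean.upper hα hE] with θ h2 h3
  rw [hZ]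
  exact le_antisymm h2 h3

/-- Let `α ∈ (0,1)`, let `μ` be an α-irrigable positive bounded Radon measure on `ℝ^d`,
let `χ` be an optimal irrigation plan for `μ` and `Z` its landscape function.
Then `I^α(μ) = ∫ Z dμ`. -/
theorem irrigationCost_eq_lintegral_landscape {d : ℕ} (α : ℝ) (hα : α ∈ Ioo (0 : ℝ) 1)
    (μ : Measure (Euc d)) [IsFiniteMeasure μ] (hirr : irrigationCost α μ ≠ ⊤)
    (χ : IrrigationPlan μ) (hopt : χ.IsOptimal α) :
    irrigationCost α μ = ∫⁻ x, χ.landscape α x ∂μ := by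
  exact main_aux α hα μ hirr χ hopt
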